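/- arXiv:1901.00638 — 4 statements merged into one kernel-verified Lean document; each statement's English description precedes it below -/
import Mathlib

section
/- Let p, q ∈ M₀([0,1],ℝ) and suppose λ ∈ ℂ is an eigenvalue of the boundary value problem i d(y')• + 2i q y' dx + y(i dq + dp) = λ y dx with boundary conditions y(1) = 0, y'(1) = y'(0), (y')•(0) = 0 (respectively y(1) = 0, y'(1) = −y'(0), (y')•(0) = 0). Then λ is real. -/
open Set Filter Topology

/-- Riemann–Stieltjes integral of `g` with respect to `f` over `[a,b]`,
defined as the limit of left-tagged uniform-partition Riemann–Stieltjes sums. -/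
noncomputable def RS (g f : ℝ → ℝ) (a b : ℝ) : ℝ :=
  limUnder Filter.atTop (fun n : ℕ =>
    ∑ i ∈ Finset.range n,
      g (a + (i : ℝ) * (b - a) / n) *
        (f (a + ((i : ℝ) + 1) * (b - a) / n) - f (a + (i : ℝ) * (b - a) / n)))

/-- Complex-valued Riemann–Stieltjes integral over `[a,b]`. -/
noncomputable def RSC (g f : ℝ → ℂ) (a b : ℝ) : ℂ :=
  limUnder Filter.atTop (fun n : ℕ =>
    ∑ i ∈ Finset.range n,
      g (a + (i : ℝ) * (b - a) / n) *
        (f (a + ((i : ℝ) + 1) * (b - a) / n) - f (a + (i : ℝ) * (b - a) / n)))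

/-- Membership in `M₀([0,1],ℝ)`: normalized (vanishing at `0`), right-continuous
on `(0,1)`, of bounded variation on `[0,1]`. -/
def MemM0 (f : ℝ → ℝ) : Prop :=
  f 0 = 0 ∧
  (∀ x ∈ Set.Ioo (0 : ℝ) 1, Filter.Tendsto f (nhdsWithin x (Set.Ioi x)) (nhds (f x))) ∧
  eVariationOn f (Set.Icc 0 1) ≠ ⊤
/-- The complex measure-coefficient `μ(t) = q(t) - i p(t) + λ i t`. -/
noncomputable def muCoef (p q : ℝ → ℝ) (lam : ℂ) : ℝ → ℂ :=
  fun t => (q t : ℂ) - Complex.I * (p t : ℂ) + lam * Complex.I * (t : ℂ)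

/-- `y` (with `y' = z`, `(y')• = w`) is a solution of the third order measure
differential equation `i d(y')• + 2iq y' dx + y (i dq + dp) = λ y dx` on `[0,1]`,
in the Lebesgue–Stieltjes integral-equation sense. -/
noncomputable def IsSolution (p q : ℝ → ℝ) (lam : ℂ) (y z w : ℝ → ℂ) : Prop :=
  ContinuousOn z (Set.Icc 0 1) ∧
  (∀ x ∈ Set.Icc (0 : ℝ) 1, y x = y 0 + ∫ t in (0:ℝ)..x, z t) ∧
  (∀ x ∈ Set.Icc (0 : ℝ) 1, z x = z 0 + ∫ t in (0:ℝ)..x, w t) ∧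
  (∀ x ∈ Set.Ioc (0 : ℝ) 1,
    w x = w 0 - (∫ t in (0:ℝ)..x, 2 * (q t : ℂ) * z t) - RSC y (muCoef p q lam) 0 x)

open MeasureTheory

lemma aux_decomp {f : ℝ → ℝ} (hf : MemM0 f) :
    ∃ a b : ℝ → ℝ, MonotoneOn a (Icc 0 1) ∧ MonotoneOn b (Icc 0 1) ∧ f = a - b :=
  BoundedVariationOn.locallyBoundedVariationOn hf.2.2 |>.exists_monotoneOn_sub_monotoneOn

lemma aux_ctrl {f : ℝ → ℝ} (hf : MemM0 f) :
    ∃ v : ℝ → ℝ, ∀ s ∈ Icc (0:ℝ) 1, ∀ t ∈ Icc (0:ℝ) 1, s ≤ t → |f t - f s| ≤ v t - v s := by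
  obtain ⟨a, b, ha, hb, rfl⟩ := aux_decomp hf
  refine ⟨a + b, fun s hs t ht hst => ?_⟩
  have h1 := ha hs ht hst
  have h2 := hb hs ht hst
  simp only [Pi.sub_apply, Pi.add_apply]
  rw [abs_le]; constructor <;> linarith

lemma aux_int {f : ℝ → ℝ} (hf : MemM0 f) :
    IntervalIntegrable (fun t => (f t : ℂ)) volume 0 1 := by
  obtain ⟨a, b, ha, hb, rfl⟩ := aux_decomp hf
  have h : uIcc (0:ℝ) 1 = Icc 0 1 := uIcc_of_le zero_le_one
  rw [← h] at ha hb
  have := (ha.intervalIntegrable (μ := volume)).sub (hb.intervalIntegrable (μ := volume))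
  exact ⟨this.1.ofReal, this.2.ofReal⟩

lemma aux_count {f : ℝ → ℝ} (hf : MemM0 f) :
    ∃ S : Set ℝ, S.Countable ∧ ∀ x ∈ Ioo (0:ℝ) 1 \ S, ContinuousAt f x := by
  obtain ⟨a, b, ha, hb, rfl⟩ := aux_decomp hf
  refine ⟨_, ha.countable_not_continuousWithinAt.union hb.countable_not_continuousWithinAt, ?_⟩
  rintro x ⟨hx, hxS⟩
  have hx' : x ∈ Icc (0:ℝ) 1 := Ioo_subset_Icc_self hx
  simp only [mem_union, not_or] at hxS
  have h1 : ContinuousWithinAt a (Icc 0 1) x := by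
    by_contra hc; exact hxS.1 ⟨hx', hc⟩
  have h2 : ContinuousWithinAt b (Icc 0 1) x := by
    by_contra hc; exact hxS.2 ⟨hx', hc⟩
  exact (h1.sub h2).continuousAt (Icc_mem_nhds hx.1 hx.2)

lemma aux_prim {F g : ℝ → ℂ} {c : ℂ} (hg : IntervalIntegrable g volume 0 1)
    (hF : ∀ x ∈ Icc (0 : ℝ) 1, F x = c + ∫ t in (0:ℝ)..x, g t) :
    ContinuousOn F (Icc 0 1) ∧
    ∀ x ∈ Ioo (0:ℝ) 1, ContinuousAt g x → HasDerivAt F (g x) x := by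
  have h : uIcc (0:ℝ) 1 = Icc 0 1 := uIcc_of_le zero_le_one
  have hg' : IntegrableOn g (Icc 0 1) :=
    (intervalIntegrable_iff_integrableOn_Icc_of_le zero_le_one).1 hg
  constructor
  · have := intervalIntegral.continuousOn_primitive_interval (μ := volume) (f := g) (a := 0) (b := 1)
      (by rwa [h])
    rw [h] at this
    exact (continuousOn_const.add this).congr hF
  · intro x hx hc
    have hi : IntervalIntegrable g volume 0 x := hg.mono_set (by
      rw [h, uIcc_of_le hx.1.le]; exact Icc_subset_Icc_right hx.2.le)
    have := intervalIntegral.integral_hasDerivAt_right hi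
      (AEStronglyMeasurable.stronglyMeasurableAtFilter_of_mem hg'.aestronglyMeasurable
        (Icc_mem_nhds hx.1 hx.2)) hc
    refine (this.const_add c).congr_of_eventuallyEq ?_
    filter_upwards [Icc_mem_nhds hx.1 hx.2] with t ht using hF t ht

lemma aux_sum (Y M : ℕ → ℂ) (n : ℕ) :
    ∑ i ∈ Finset.range n, Y i * (M (i+1) - M i) =
      Y n * M n - Y 0 * M 0 - ∑ i ∈ Finset.range n, M (i+1) * (Y (i+1) - Y i) := by
  induction n with
  | zero => simp
  | succ k ih => rw [Finset.sum_range_succ, Finset.sum_range_succ, ih]; ring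

lemma aux_RSC {y z m : ℝ → ℂ} {v : ℝ → ℝ} {x : ℝ} (hx : x ∈ Ioc (0:ℝ) 1)
    (hz : ContinuousOn z (Icc 0 1))
    (hy : ∀ x ∈ Icc (0 : ℝ) 1, y x = y 0 + ∫ t in (0:ℝ)..x, z t)
    (hm : IntervalIntegrable m volume 0 1)
    (hv : ∀ s ∈ Icc (0:ℝ) 1, ∀ t ∈ Icc (0:ℝ) 1, s ≤ t → ‖m t - m s‖ ≤ v t - v s) :
    RSC y m 0 x = y x * m x - y 0 * m 0 - ∫ t in (0:ℝ)..x, m t * z t := by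
  have h01 : uIcc (0:ℝ) 1 = Icc 0 1 := uIcc_of_le zero_le_one
  obtain ⟨C, hC⟩ := isCompact_Icc.exists_bound_of_continuousOn hz
  have hC0 : 0 ≤ C := (norm_nonneg _).trans (hC 0 (by simp))
  have hzi : ∀ a ∈ Icc (0:ℝ) 1, ∀ b ∈ Icc (0:ℝ) 1, IntervalIntegrable z volume a b := by
    intro a ha b hb
    apply (hz.mono _).intervalIntegrable
    rw [← h01] at *
    exact uIcc_subset_uIcc ha hb
  have hmzi1 : IntervalIntegrable (fun t => m t * z t) volume 0 1 :=
    hm.mul_continuousOn (by rwa [h01])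
  have hmzi : ∀ a ∈ Icc (0:ℝ) 1, ∀ b ∈ Icc (0:ℝ) 1,
      IntervalIntegrable (fun t => m t * z t) volume a b := by
    intro a ha b hb
    apply hmzi1.mono_set
    rw [← h01] at *
    exact uIcc_subset_uIcc ha hb
  apply Tendsto.limUnder_eq
  rw [tendsto_iff_norm_sub_tendsto_zero]
  have hlim : Tendsto (fun n : ℕ => (C * (v x - v 0) * x) / (n:ℝ)) atTop (𝓝 0) :=
    tendsto_const_div_atTop_nhds_zero_nat _
  refine squeeze_zero' (Eventually.of_forall fun _ => norm_nonneg _) ?_ hlim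
  filter_upwards [eventually_gt_atTop 0] with n hn
  have hn' : (0:ℝ) < n := by exact_mod_cast hn
  let T : ℕ → ℝ := fun i => (i:ℝ) * x / n
  have hT0 : T 0 = 0 := by simp [T]
  have hTn : T n = x := by simp only [T]; field_simp
  have hTs : ∀ i, T (i+1) - T i = x / n := by intro i; simp only [T]; push_cast; ring
  have hxn : 0 < x / n := div_pos hx.1 hn'
  have hTm : ∀ i ≤ n, T i ∈ Icc (0:ℝ) 1 := by
    intro i hi
    have hi' : (i:ℝ) ≤ n := by exact_mod_cast hi
    refine ⟨by have := hx.1.le; positivity, ?_⟩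
    simp only [T]
    rw [div_le_one hn']
    nlinarith [hx.1, hx.2]
  have e1 : ∑ i ∈ Finset.range n, y (0 + (i : ℝ) * (x - 0) / n) *
        (m (0 + ((i : ℝ) + 1) * (x - 0) / n) - m (0 + (i : ℝ) * (x - 0) / n))
      = ∑ i ∈ Finset.range n, y (T i) * (m (T (i+1)) - m (T i)) := by
    apply Finset.sum_congr rfl
    intro i _
    simp [T]
  rw [e1, aux_sum (fun i => y (T i)) (fun i => m (T i)) n]
  simp only [hT0, hTn]
  have e2 : ∫ t in (0:ℝ)..x, m t * z t =
      ∑ i ∈ Finset.range n, ∫ t in (T i)..(T (i+1)), m t * z t := by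
    rw [intervalIntegral.sum_integral_adjacent_intervals (a := T), hT0, hTn]
    intro k hk
    exact hmzi _ (hTm _ hk.le) _ (hTm _ hk)
  rw [e2]
  have e3 : ∀ A S1 S2 : ℂ, A - S1 - (A - S2) = S2 - S1 := by intros; ring
  rw [e3, ← Finset.sum_sub_distrib]
  refine (norm_sum_le _ _).trans ?_
  have e4 : C * (v x - v 0) * x / n =
      ∑ i ∈ Finset.range n, (v (T (i+1)) - v (T i)) * C * (x / n) := by
    rw [← Finset.sum_mul, ← Finset.sum_mul, Finset.sum_range_sub (fun i => v (T i)), hT0, hTn]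
    ring
  rw [e4]
  apply Finset.sum_le_sum
  intro i hi
  have hi' := Finset.mem_range.1 hi
  have m1 := hTm i hi'.le
  have m2 := hTm (i+1) hi'
  have hle : T i ≤ T (i+1) := by linarith [hTs i]
  have e5 : y (T (i+1)) - y (T i) = ∫ t in (T i)..(T (i+1)), z t := by
    rw [hy _ m1, hy _ m2, add_sub_add_left_eq_sub,
      intervalIntegral.integral_interval_sub_left (hzi _ (by simp) _ m2) (hzi _ (by simp) _ m1)]
  rw [e5, ← intervalIntegral.integral_const_mul,
    ← intervalIntegral.integral_sub (hmzi _ m1 _ m2) ((hzi _ m1 _ m2).const_mul _)]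
  have := intervalIntegral.norm_integral_le_of_norm_le_const (a := T i) (b := T (i+1))
    (f := fun t => m t * z t - m (T (i+1)) * z t) (C := (v (T (i+1)) - v (T i)) * C) ?_
  · rwa [hTs, abs_of_pos hxn] at this
  · intro t ht
    rw [uIoc_of_le hle] at ht
    have mt : t ∈ Icc (0:ℝ) 1 := ⟨m1.1.trans ht.1.le, ht.2.trans m2.2⟩
    have h1 := hv t mt _ m2 ht.2
    have h2 := (norm_nonneg _).trans (hv _ m1 t mt ht.1.le)
    rw [← sub_mul, norm_mul]
    refine mul_le_mul ?_ (hC t mt) (norm_nonneg _) ?_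
    · rw [norm_sub_rev]; linarith
    · have := (norm_nonneg _).trans h1
      linarith

/-- All eigenvalues of the boundary value problems `(BC)₁`, `(BC)₂` for the third order
measure differential equation are real. -/
theorem eigenvalues_real
    (p q : ℝ → ℝ) (hp : MemM0 p) (hq : MemM0 q) (lam : ℂ)
    (heig : ∃ y z w : ℝ → ℂ, IsSolution p q lam y z w ∧
      (¬ ∀ x ∈ Icc (0 : ℝ) 1, y x = 0) ∧
      y 1 = 0 ∧ (z 1 = z 0 ∨ z 1 = -z 0) ∧ w 0 = 0) :
    lam.im = 0 := by
  obtain ⟨y, z, w, ⟨hz, hy, hzw, hw⟩, hne, hy1, hbc, hw0⟩ := heig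
  by_contra hb
  have h01 : uIcc (0:ℝ) 1 = Icc 0 1 := uIcc_of_le zero_le_one
  have hiq := aux_int hq
  have hip := aux_int hp
  have hit : IntervalIntegrable (fun t : ℝ => (t : ℂ)) volume 0 1 :=
    Complex.continuous_ofReal.intervalIntegrable _ _
  set m : ℝ → ℂ := muCoef p q lam with hmdef
  have hm : IntervalIntegrable m volume 0 1 :=
    (hiq.sub (hip.const_mul Complex.I)).add (hit.const_mul (lam * Complex.I))
  have hm0 : m 0 = 0 := by simp [hmdef, muCoef, hp.1, hq.1]
  obtain ⟨vp, hvp⟩ := aux_ctrl hp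
  obtain ⟨vq, hvq⟩ := aux_ctrl hq
  have hv : ∀ s ∈ Icc (0:ℝ) 1, ∀ t ∈ Icc (0:ℝ) 1, s ≤ t →
      ‖m t - m s‖ ≤ (vq t + vp t + ‖lam‖ * t) - (vq s + vp s + ‖lam‖ * s) := by
    intro s hs t ht hst
    have e : m t - m s = ((q t - q s : ℝ) : ℂ) + (-Complex.I) * ((p t - p s : ℝ) : ℂ)
        + lam * Complex.I * ((t - s : ℝ) : ℂ) := by
      simp only [hmdef, muCoef]; push_cast; ring
    rw [e]
    refine (norm_add₃_le).trans ?_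
    simp only [norm_mul, norm_neg, Complex.norm_I, Complex.norm_real, Real.norm_eq_abs, one_mul,
      mul_one]
    rw [abs_of_nonneg (sub_nonneg.2 hst)]
    linarith [hvp s hs t ht hst, hvq s hs t ht hst]
  have hzc : ContinuousOn z (uIcc 0 1) := by rwa [h01]
  have hzi : IntervalIntegrable z volume 0 1 := hzc.intervalIntegrable
  have hmz : IntervalIntegrable (fun t => m t * z t) volume 0 1 := hm.mul_continuousOn hzc
  have hqz : IntervalIntegrable (fun t => 2 * (q t : ℂ) * z t) volume 0 1 :=
    (hiq.const_mul 2).mul_continuousOn hzc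
  -- the regularised second derivative
  let g : ℝ → ℂ := fun t => m t * z t - 2 * (q t : ℂ) * z t
  have hg : IntervalIntegrable g volume 0 1 := hmz.sub hqz
  let W : ℝ → ℂ := fun x => 0 + ∫ t in (0:ℝ)..x, g t
  have hwW : ∀ x ∈ Icc (0:ℝ) 1, w x = W x - y x * m x := by
    intro x hx
    rcases eq_or_lt_of_le hx.1 with h | h
    · subst h; simp [W, hw0, hm0]
    · have hs : uIcc (0:ℝ) x ⊆ uIcc 0 1 := by
        rw [h01, uIcc_of_le hx.1]; exact Icc_subset_Icc_right hx.2
      rw [hw x ⟨h, hx.2⟩, aux_RSC ⟨h, hx.2⟩ hz hy hm hv, hw0, hm0]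
      simp only [W, g]
      rw [intervalIntegral.integral_sub (hmz.mono_set hs) (hqz.mono_set hs)]
      ring
  obtain ⟨hyc, hyd⟩ := aux_prim hzi hy
  obtain ⟨hWc, hWd⟩ := aux_prim (F := W) hg (fun x _ => rfl)
  have hwi : IntervalIntegrable w volume 0 1 := by
    have : IntervalIntegrable (fun x => W x - y x * m x) volume 0 1 := by
      refine IntervalIntegrable.sub (ContinuousOn.intervalIntegrable (by rwa [h01])) ?_
      exact hm.continuousOn_mul (by rwa [h01])
    refine this.congr ?_
    intro x hx
    rw [uIoc_of_le zero_le_one] at hx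
    exact (hwW x (Ioc_subset_Icc_self hx)).symm
  obtain ⟨_, hzd⟩ := aux_prim hwi hzw
  obtain ⟨Sp, hSp, hcp⟩ := aux_count hp
  obtain ⟨Sq, hSq, hcq⟩ := aux_count hq
  let G : ℝ → ℂ := fun t => (1/2) * (star (z t) * z t) - star (y t) * W t
    - lam.im * ((t:ℂ) * (star (y t) * y t))
  have hGc : ContinuousOn G (Icc 0 1) := by
    have h1 : ContinuousOn (fun t => star (z t)) (Icc (0:ℝ) 1) := hz.star
    have h2 : ContinuousOn (fun t => star (y t)) (Icc (0:ℝ) 1) := hyc.star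
    have h3 : ContinuousOn (fun t : ℝ => (t:ℂ)) (Icc (0:ℝ) 1) :=
      Complex.continuous_ofReal.continuousOn
    exact ((continuousOn_const.mul (h1.mul hz)).sub (h2.mul hWc)).sub
      (continuousOn_const.mul (h3.mul (h2.mul hyc)))
  have hFd : ∀ x ∈ Ioo (0:ℝ) 1 \ (Sp ∪ Sq),
      HasDerivAt (fun t => (G t).re) (-lam.im * Complex.normSq (y x)) x := by
    rintro x ⟨hx, hxS⟩
    simp only [mem_union, not_or] at hxS
    have hxI : x ∈ Icc (0:ℝ) 1 := Ioo_subset_Icc_self hx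
    have hnx : Icc (0:ℝ) 1 ∈ 𝓝 x := Icc_mem_nhds hx.1 hx.2
    have cq : ContinuousAt (fun t => (q t : ℂ)) x :=
      Complex.continuous_ofReal.continuousAt.comp (hcq x ⟨hx, hxS.2⟩)
    have cp : ContinuousAt (fun t => (p t : ℂ)) x :=
      Complex.continuous_ofReal.continuousAt.comp (hcp x ⟨hx, hxS.1⟩)
    have cm : ContinuousAt m x :=
      (cq.sub (continuousAt_const.mul cp)).add
        (continuousAt_const.mul Complex.continuous_ofReal.continuousAt)
    have cz : ContinuousAt z x := hz.continuousAt hnx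
    have cg : ContinuousAt g x := (cm.mul cz).sub ((continuousAt_const.mul cq).mul cz)
    have cw : ContinuousAt w x := by
      have : ContinuousAt (fun x => W x - y x * m x) x :=
        (hWc.continuousAt hnx).sub ((hyc.continuousAt hnx).mul cm)
      refine this.congr ?_
      filter_upwards [hnx] with t ht using (hwW t ht).symm
    have dy := hyd x hx cz
    have dz := hzd x hx cw
    have dW := hWd x hx cg
    have dt : HasDerivAt (fun t : ℝ => (t:ℂ)) 1 x := Complex.ofRealCLM.hasDerivAt
    have dys : HasDerivAt (fun t => star (y t)) (star (z x)) x := dy.star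
    have dzs : HasDerivAt (fun t => star (z t)) (star (w x)) x := dz.star
    have dG := (((dzs.mul dz).const_mul (1/2 : ℂ)).sub (dys.mul dW)).sub
      ((dt.mul (dys.mul dy)).const_mul (lam.im : ℂ))
    have dR := Complex.reCLM.hasFDerivAt.comp_hasDerivAt x dG
    refine HasDerivAt.congr_deriv (f := fun t => (G t).re) dR ?_
    rw [hwW x hxI]
    simp only [g, hmdef, muCoef, Complex.reCLM_apply, Complex.normSq_apply]
    simp
    ring
  have hyn : ContinuousOn (fun x => Complex.normSq (y x)) (Icc 0 1) :=
    Complex.continuous_normSq.comp_continuousOn hyc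
  have key := MeasureTheory.integral_eq_of_hasDerivAt_off_countable_of_le
    (fun t => (G t).re) (fun x => -lam.im * Complex.normSq (y x)) (zero_le_one' ℝ)
    (hSp.union hSq) (Complex.continuous_re.comp_continuousOn hGc) hFd
    (ContinuousOn.intervalIntegrable (by rw [h01]; exact continuousOn_const.mul hyn))
  have hG : (G 1).re - (G 0).re = 0 := by
    have : star (z 1) * z 1 = star (z 0) * z 0 := by
      rcases hbc with h | h <;> simp [h]
    have hW0 : W 0 = 0 := by simp [W]
    simp only [G, this, hy1, hW0]
    simp
  rw [hG, intervalIntegral.integral_const_mul] at key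
  have hpos : 0 < ∫ x in (0:ℝ)..1, Complex.normSq (y x) := by
    refine intervalIntegral.integral_pos one_pos hyn (fun x _ => Complex.normSq_nonneg _) ?_
    push Not at hne
    obtain ⟨c, hc, hyc0⟩ := hne
    exact ⟨c, hc, Complex.normSq_pos.2 hyc0⟩
  rcases mul_eq_zero.1 key with h | h
  · exact hb (neg_eq_zero.1 h)
  · exact hpos.ne' h
end

section
/- Let p, q ∈ M₀([0,1],ℝ), and for each λ ∈ ℂ let y(·,λ) be the solution of i d(y')• + 2iq y' dx + y(i dq + dp) = λ y dx with fixed initial data (y(0), y'(0), (y')•(0)) ∈ ℝ³. Then for each fixed x ∈ [0,1], the maps λ ↦ y(x,λ), λ ↦ y'(x,λ), and λ ↦ (y')•(x,λ) are entire functions of λ. -/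
open Set Filter Topology

lemma diff_inv {R : Type*} [NormedRing R] [NormedAlgebra ℂ R] [CompleteSpace R] (a b : R) (l : ℂ)
    (h : IsUnit (1 - (a + l • b))) :
    DifferentiableAt ℂ (fun l : ℂ => Ring.inverse (1 - (a + l • b))) l := by
  have e : DifferentiableAt ℂ (fun l : ℂ => 1 - (a + l • b)) l := by fun_prop
  exact (differentiableAt_inverse (𝕜 := ℂ) h).comp l e

section volterra
open MeasureTheory
variable {F : Type*} [NormedAddCommGroup F] [NormedSpace ℂ F] [CompleteSpace F]

lemma vol_integrable (M : ℝ → F →L[ℂ] F) (hM : IntervalIntegrable M volume 0 1)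
    (C : ℝ) (hC : ∀ t ∈ Icc (0:ℝ) 1, ‖M t‖ ≤ C) (g : ℝ → F) (hg : ContinuousOn g (Icc 0 1)) :
    IntervalIntegrable (fun t => M t (g t)) volume 0 1 := by
  obtain ⟨G, hG⟩ := isCompact_Icc.exists_bound_of_continuousOn hg
  rw [intervalIntegrable_iff_integrableOn_Ioc_of_le zero_le_one] at hM ⊢
  have hgm : AEStronglyMeasurable g (volume.restrict (Ioc (0:ℝ) 1)) :=
    (hg.mono Ioc_subset_Icc_self).aestronglyMeasurable measurableSet_Ioc
  refine Integrable.mono' (g := fun _ => C * G) (integrable_const _) ?_ ?_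
  · exact (ContinuousLinearMap.id ℂ (F →L[ℂ] F)).aestronglyMeasurable_comp₂
      hM.aestronglyMeasurable hgm
  · filter_upwards [ae_restrict_mem measurableSet_Ioc] with t ht
    have ht' := Ioc_subset_Icc_self ht
    exact (M t).le_of_opNorm_le_of_le (hC t ht') (hG t ht')

lemma sub_int {E : Type*} [NormedAddCommGroup E] {f : ℝ → E}
    (hf : IntervalIntegrable f volume 0 1) {a b : ℝ}
    (ha : a ∈ Icc (0:ℝ) 1) (hb : b ∈ Icc (0:ℝ) 1) : IntervalIntegrable f volume a b := by
  refine hf.mono_set ?_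
  rw [uIcc_of_le (zero_le_one' ℝ)]
  exact ordConnected_Icc.uIcc_subset ha hb

lemma ext_cont (g : C(Icc (0:ℝ) 1, F)) : Continuous (fun t => g (projIcc 0 1 zero_le_one t)) :=
  g.continuous.comp continuous_projIcc

lemma exists_vol (M : ℝ → F →L[ℂ] F) (hM : IntervalIntegrable M volume 0 1)
    (C : ℝ) (hC : ∀ t ∈ Icc (0:ℝ) 1, ‖M t‖ ≤ C) :
    ∃ V : C(Icc (0:ℝ) 1, F) →L[ℂ] C(Icc (0:ℝ) 1, F), ∀ g x,
      V g x = ∫ t in (0:ℝ)..x, M t (g (projIcc 0 1 zero_le_one t)) := by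
  have hint : ∀ g : C(Icc (0:ℝ) 1, F),
      IntervalIntegrable (fun t => M t (g (projIcc 0 1 zero_le_one t))) volume 0 1 := fun g =>
    vol_integrable M hM C hC _ (ext_cont g).continuousOn
  have hC0 : 0 ≤ C := (norm_nonneg _).trans (hC 0 (by simp))
  let L : C(Icc (0:ℝ) 1, F) →ₗ[ℂ] C(Icc (0:ℝ) 1, F) :=
    { toFun := fun g => ⟨fun x => ∫ t in (0:ℝ)..x, M t (g (projIcc 0 1 zero_le_one t)), by
          have := intervalIntegral.continuousOn_primitive_interval' (hint g) left_mem_uIcc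
          rw [uIcc_of_le (zero_le_one' ℝ)] at this
          exact this.comp_continuous continuous_subtype_val (fun x => x.2)⟩
      map_add' := fun g h => by
        ext x
        simp only [ContinuousMap.coe_mk, ContinuousMap.add_apply, map_add]
        exact intervalIntegral.integral_add (sub_int (hint g) (by simp) x.2)
          (sub_int (hint h) (by simp) x.2)
      map_smul' := fun c g => by
        ext x
        simp [intervalIntegral.integral_smul] }
  refine ⟨L.mkContinuous C ?_, fun g x => rfl⟩
  intro g
  rw [ContinuousMap.norm_le _ (by positivity)]
  intro x
  have h := intervalIntegral.norm_integral_le_of_norm_le_const (a := 0) (b := x)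
    (f := fun t => M t (g (projIcc 0 1 zero_le_one t))) (C := C * ‖g‖) (by
      intro t ht
      rw [uIoc_of_le x.2.1] at ht
      exact (M t).le_of_opNorm_le_of_le (hC t ⟨ht.1.le, ht.2.trans x.2.2⟩) (g.norm_coe_le_norm _))
  refine h.trans ?_
  rw [sub_zero, abs_of_nonneg x.2.1]
  exact mul_le_of_le_one_right (by positivity) x.2.2

lemma vol_unit (M : ℝ → F →L[ℂ] F)
    (C : ℝ) (hC : ∀ t ∈ Icc (0:ℝ) 1, ‖M t‖ ≤ C)
    (V : C(Icc (0:ℝ) 1, F) →L[ℂ] C(Icc (0:ℝ) 1, F)) (hV : ∀ g x,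
      V g x = ∫ t in (0:ℝ)..x, M t (g (projIcc 0 1 zero_le_one t))) : IsUnit (1 - V) := by
  have hC0 : 0 ≤ C := (norm_nonneg _).trans (hC 0 (by simp))
  have key : ∀ (n : ℕ) (g : C(Icc (0:ℝ) 1, F)) (x : Icc (0:ℝ) 1),
      ‖(V ^ n) g x‖ ≤ C ^ n * (x:ℝ) ^ n / n.factorial * ‖g‖ := by
    intro n g
    induction n with
    | zero => intro x; simpa using g.norm_coe_le_norm x
    | succ n ih =>
      intro x
      rw [pow_succ', mul_apply_eq_comp, hV]
      have h := intervalIntegral.norm_integral_le_of_norm_le (μ := volume) (a := 0) (b := x)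
        (f := fun t => M t ((V ^ n) g (projIcc 0 1 zero_le_one t)))
        (g := fun t => (C ^ (n + 1) / n.factorial * ‖g‖) * t ^ n) x.2.1 (by
          refine Eventually.of_forall fun t ht => ?_
          have ht' : t ∈ Icc (0:ℝ) 1 := ⟨ht.1.le, ht.2.trans x.2.2⟩
          have h1 := ih ⟨t, ht'⟩
          have h2 := (M t).le_of_opNorm_le_of_le (hC t ht') h1
          rw [projIcc_of_mem _ ht']
          refine h2.trans (le_of_eq ?_)
          simp only
          ring)
        (Continuous.intervalIntegrable (by fun_prop) _ _)
      refine h.trans (le_of_eq ?_)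
      rw [intervalIntegral.integral_const_mul, integral_pow, Nat.factorial_succ]
      push_cast
      have : (n.factorial : ℝ) ≠ 0 := by positivity
      field_simp
      simp
  obtain ⟨n, hn⟩ := ((FloorSemiring.tendsto_pow_div_factorial_atTop C).eventually
    (gt_mem_nhds (zero_lt_one' ℝ))).exists
  have hlt : ‖V ^ n‖ < 1 := by
    refine lt_of_le_of_lt (ContinuousLinearMap.opNorm_le_bound _ (by positivity) fun g => ?_) hn
    rw [ContinuousMap.norm_le _ (by positivity)]
    intro x
    refine (key n g x).trans ?_
    gcongr
    exact mul_le_of_le_one_right (by positivity) (pow_le_one₀ x.2.1 x.2.2)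
  have hu := isUnit_one_sub_of_norm_lt_one
    (R := C(Icc (0:ℝ) 1, F) →L[ℂ] C(Icc (0:ℝ) 1, F)) hlt
  rw [← mul_neg_geom_sum] at hu
  have hcomm : Commute (1 - V) (∑ i ∈ Finset.range n, V ^ i) := by
    refine Commute.sum_right _ _ _ fun i _ => ?_
    exact ((Commute.one_left V).sub_left (Commute.refl V)).pow_right i
  exact (hcomm.isUnit_mul_iff.1 hu).1

lemma vol_entire (A B : ℝ → F →L[ℂ] F) (hA : IntervalIntegrable A volume 0 1)
    (hB : IntervalIntegrable B volume 0 1) (CA CB : ℝ)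
    (hCA : ∀ t ∈ Icc (0:ℝ) 1, ‖A t‖ ≤ CA) (hCB : ∀ t ∈ Icc (0:ℝ) 1, ‖B t‖ ≤ CB)
    (Y0 : F) (Y : ℂ → ℝ → F) (hc : ∀ l, ContinuousOn (Y l) (Icc 0 1))
    (h : ∀ l, ∀ x ∈ Icc (0:ℝ) 1, Y l x = Y0 + ∫ t in (0:ℝ)..x, (A t + l • B t) (Y l t)) :
    ∀ x ∈ Icc (0:ℝ) 1, Differentiable ℂ (fun l => Y l x) := by
  intro x hx
  obtain ⟨VA, hVA⟩ := exists_vol A hA CA hCA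
  obtain ⟨VB, hVB⟩ := exists_vol B hB CB hCB
  have hV : ∀ l : ℂ, ∀ g x, (VA + l • VB) g x =
      ∫ t in (0:ℝ)..x, (A t + l • B t) (g (projIcc 0 1 zero_le_one t)) := by
    intro l g x
    have i1 := sub_int (vol_integrable A hA CA hCA _ (ext_cont g).continuousOn)
      (a := 0) (by simp) x.2
    have i2 := sub_int (vol_integrable B hB CB hCB _ (ext_cont g).continuousOn)
      (a := 0) (by simp) x.2
    simp only [add_apply, smul_apply,
      ContinuousMap.add_apply, ContinuousMap.smul_apply, hVA, hVB]
    rw [← intervalIntegral.integral_smul]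
    exact (intervalIntegral.integral_add i1 (i2.smul l)).symm
  have hunit : ∀ l : ℂ, IsUnit (1 - (VA + l • VB)) := fun l =>
    vol_unit (fun t => A t + l • B t) (CA + ‖l‖ * CB) (fun t ht => by
      refine (norm_add_le _ _).trans (add_le_add (hCA t ht) ?_)
      rw [norm_smul]
      exact mul_le_mul_of_nonneg_left (hCB t ht) (norm_nonneg _)) _ (hV l)
  have hY : ∀ l, Y l x = (Ring.inverse (1 - (VA + l • VB)))
      (ContinuousMap.const _ Y0) ⟨x, hx⟩ := by
    intro l
    let g : C(Icc (0:ℝ) 1, F) := ⟨(Icc (0:ℝ) 1).domRestrict (Y l), (hc l).domRestrict⟩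
    have hg : (1 - (VA + l • VB)) g = ContinuousMap.const _ Y0 := by
      ext s
      rw [sub_apply, ContinuousMap.sub_apply, hV]
      change Y l s - _ = Y0
      rw [h l s s.2, sub_eq_iff_eq_add]
      congr 1
      refine intervalIntegral.integral_congr fun t ht => ?_
      rw [uIcc_of_le s.2.1] at ht
      have ht' : t ∈ Icc (0:ℝ) 1 := ⟨ht.1, ht.2.trans s.2.2⟩
      simp only [projIcc_of_mem _ ht']
      rfl
    rw [← hg, ← mul_apply_eq_comp, Ring.inverse_mul_cancel _ (hunit l)]
    rfl
  simp_rw [hY]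
  intro l
  have d1 : DifferentiableAt ℂ (fun l : ℂ => Ring.inverse (1 - (VA + l • VB))) l :=
    diff_inv VA VB l (hunit l)
  have d2 := d1.clm_apply (differentiableAt_const (c := ContinuousMap.const (Icc (0:ℝ) 1) Y0))
  exact ((ContinuousMap.evalCLM ℂ (⟨x, hx⟩ : Icc (0:ℝ) 1)).differentiableAt).comp l d2

end volterra

section rs
open MeasureTheory

lemma rsc_eq (mu y z : ℝ → ℂ) (m : ℝ → ℝ)
    (hdom : ∀ s ∈ Icc (0:ℝ) 1, ∀ t ∈ Icc (0:ℝ) 1, s ≤ t → ‖mu t - mu s‖ ≤ m t - m s)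
    (hmu : IntervalIntegrable mu volume 0 1) (hz : ContinuousOn z (Icc 0 1))
    (hy : ∀ x ∈ Icc (0 : ℝ) 1, y x = y 0 + ∫ t in (0:ℝ)..x, z t)
    (x : ℝ) (hx : x ∈ Icc (0:ℝ) 1) :
    RSC y mu 0 x = y x * mu x - y 0 * mu 0 - ∫ t in (0:ℝ)..x, mu t * z t := by
  obtain ⟨Z, hZ⟩ := isCompact_Icc.exists_bound_of_continuousOn hz
  have hzi : IntervalIntegrable z volume 0 1 := by
    apply ContinuousOn.intervalIntegrable
    rwa [uIcc_of_le zero_le_one]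
  have hmz : IntervalIntegrable (fun t => mu t * z t) volume 0 1 := by
    apply hmu.mul_continuousOn
    rwa [uIcc_of_le zero_le_one]
  refine Tendsto.limUnder_eq ?_
  rw [tendsto_iff_norm_sub_tendsto_zero]
  have hlim : Tendsto (fun n : ℕ => (m x - m 0) * Z * x / n) atTop (𝓝 0) :=
    tendsto_const_div_atTop_nhds_zero_nat _
  refine squeeze_zero' (Eventually.of_forall fun _ => norm_nonneg _) ?_ hlim
  filter_upwards [eventually_gt_atTop 0] with n hn
  have hn' : (0:ℝ) < n := by exact_mod_cast hn
  let a : ℕ → ℝ := fun i => 0 + (i:ℝ) * (x - 0) / n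
  have ha0 : a 0 = 0 := by simp [a]
  have han : a n = x := by simp only [a]; field_simp; ring
  have hstep : ∀ i, a (i+1) - a i = x / n := by
    intro i; simp only [a]; push_cast; field_simp; ring
  have hmem : ∀ i ≤ n, a i ∈ Icc (0:ℝ) 1 := by
    intro i hi
    have hi' : (i:ℝ) ≤ n := by exact_mod_cast hi
    have h0 := hx.1
    constructor
    · simp only [a, zero_add, sub_zero]; positivity
    · simp only [a, zero_add, sub_zero]
      rw [div_le_one hn']
      nlinarith [hx.2, (Nat.cast_nonneg i : (0:ℝ) ≤ i)]
  have hle : ∀ i, a i ≤ a (i+1) := by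
    intro i
    have := hstep i
    have h2 : 0 ≤ x / n := div_nonneg hx.1 hn'.le
    linarith
  have hsum : ∑ i ∈ Finset.range n,
      y (0 + (i : ℝ) * (x - 0) / n) *
        (mu (0 + ((i : ℝ) + 1) * (x - 0) / n) - mu (0 + (i : ℝ) * (x - 0) / n))
      = ∑ i ∈ Finset.range n, y (a i) * (mu (a (i+1)) - mu (a i)) := by
    refine Finset.sum_congr rfl fun i _ => ?_
    simp only [a]; push_cast; rfl
  have hparts : ∑ i ∈ Finset.range n, y (a i) * (mu (a (i+1)) - mu (a i))
      = y x * mu x - y 0 * mu 0 - ∑ i ∈ Finset.range n, mu (a (i+1)) * (y (a (i+1)) - y (a i)) := by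
    have := Finset.sum_range_sub (fun i => y (a i) * mu (a i)) n
    rw [han, ha0] at this
    rw [← this, ← Finset.sum_sub_distrib]
    refine Finset.sum_congr rfl fun i _ => ?_
    ring
  have hint : ∫ t in (0:ℝ)..x, mu t * z t
      = ∑ i ∈ Finset.range n, ∫ t in (a i)..(a (i+1)), mu t * z t := by
    rw [intervalIntegral.sum_integral_adjacent_intervals, ha0, han]
    intro k hk
    exact sub_int hmz (hmem k hk.le) (hmem (k+1) hk)
  rw [hsum, hparts, hint, sub_sub_sub_cancel_left, ← Finset.sum_sub_distrib]
  have hbound : ∀ i ∈ Finset.range n,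
      ‖(∫ t in (a i)..(a (i+1)), mu t * z t) - mu (a (i+1)) * (y (a (i+1)) - y (a i))‖
        ≤ (m (a (i+1)) - m (a i)) * Z * (x / n) := by
    intro i hi
    have hi' := Finset.mem_range.1 hi
    have m1 := hmem i hi'.le
    have m2 := hmem (i+1) hi'
    have e : y (a (i+1)) - y (a i) = ∫ t in (a i)..(a (i+1)), z t := by
      rw [hy _ m1, hy _ m2, add_sub_add_left_eq_sub]
      exact intervalIntegral.integral_interval_sub_left (sub_int hzi (by simp) m2)
        (sub_int hzi (by simp) m1)
    rw [e, ← intervalIntegral.integral_const_mul, ← intervalIntegral.integral_sub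
      (sub_int hmz m1 m2) ((sub_int hzi m1 m2).const_mul _)]
    refine (intervalIntegral.norm_integral_le_of_norm_le_const
      (C := (m (a (i+1)) - m (a i)) * Z) ?_).trans ?_
    · intro t ht
      rw [uIoc_of_le (hle i)] at ht
      have ht' : t ∈ Icc (0:ℝ) 1 := ⟨m1.1.trans ht.1.le, ht.2.trans m2.2⟩
      rw [← sub_mul, norm_mul, norm_sub_rev]
      have h1 := hdom t ht' _ m2 ht.2
      have h2 := (norm_nonneg _).trans (hdom _ m1 t ht' ht.1.le)
      exact mul_le_mul (by linarith) (hZ t ht') (norm_nonneg _)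
        ((norm_nonneg _).trans (h1.trans (by linarith)))
    · rw [hstep, abs_of_nonneg (div_nonneg hx.1 hn'.le)]
  refine (norm_sum_le _ _).trans ((Finset.sum_le_sum hbound).trans (le_of_eq ?_))
  rw [← Finset.sum_mul, ← Finset.sum_mul, Finset.sum_range_sub (fun i => m (a i)), ha0, han]
  ring

lemma memM0_dom (f : ℝ → ℝ) (hf : MemM0 f) : ∃ m : ℝ → ℝ,
    (∀ s ∈ Icc (0:ℝ) 1, ∀ t ∈ Icc (0:ℝ) 1, s ≤ t → |f t - f s| ≤ m t - m s) ∧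
    IntervalIntegrable f volume 0 1 ∧ ∃ C, ∀ t ∈ Icc (0:ℝ) 1, |f t| ≤ C := by
  have hb : BoundedVariationOn f (Icc 0 1) := hf.2.2
  obtain ⟨u, v, hu, hv, rfl⟩ := hb.locallyBoundedVariationOn.exists_monotoneOn_sub_monotoneOn
  have dom : ∀ s ∈ Icc (0:ℝ) 1, ∀ t ∈ Icc (0:ℝ) 1, s ≤ t →
      |(u - v) t - (u - v) s| ≤ (u + v) t - (u + v) s := by
    intro s hs t ht hst
    have h1 := hu hs ht hst
    have h2 := hv hs ht hst
    simp only [Pi.sub_apply, Pi.add_apply]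
    rw [abs_le]; constructor <;> linarith
  refine ⟨u + v, dom, ?_, (u + v) 1 - (u + v) 0, ?_⟩
  · rw [← uIcc_of_le (zero_le_one' ℝ)] at hu hv
    exact hu.intervalIntegrable.sub hv.intervalIntegrable
  · intro t ht
    have h1 := dom 0 (by simp) t ht ht.1
    have h2 := (abs_nonneg _).trans (dom t ht 1 (by simp) ht.2)
    rw [hf.1, sub_zero] at h1
    linarith
end rs

section main
open MeasureTheory

/-- Constant matrix `(a,b,c) ↦ (b,c,0)`. -/
noncomputable def auxN0 : (ℂ × ℂ × ℂ) →L[ℂ] (ℂ × ℂ × ℂ) :=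
  ((ContinuousLinearMap.fst ℂ ℂ ℂ).comp (ContinuousLinearMap.snd ℂ ℂ (ℂ × ℂ))).prod
    (((ContinuousLinearMap.snd ℂ ℂ ℂ).comp (ContinuousLinearMap.snd ℂ ℂ (ℂ × ℂ))).prod 0)

/-- Constant matrix `(a,b,c) ↦ (0,-a,b)`. -/
noncomputable def auxN1 : (ℂ × ℂ × ℂ) →L[ℂ] (ℂ × ℂ × ℂ) :=
  (0 : (ℂ × ℂ × ℂ) →L[ℂ] ℂ).prod ((-(ContinuousLinearMap.fst ℂ ℂ (ℂ × ℂ))).prod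
    ((ContinuousLinearMap.fst ℂ ℂ ℂ).comp (ContinuousLinearMap.snd ℂ ℂ (ℂ × ℂ))))

/-- Constant matrix `(a,b,c) ↦ (0,0,b)`. -/
noncomputable def auxN2 : (ℂ × ℂ × ℂ) →L[ℂ] (ℂ × ℂ × ℂ) :=
  (0 : (ℂ × ℂ × ℂ) →L[ℂ] ℂ).prod ((0 : (ℂ × ℂ × ℂ) →L[ℂ] ℂ).prod
    ((ContinuousLinearMap.fst ℂ ℂ ℂ).comp (ContinuousLinearMap.snd ℂ ℂ (ℂ × ℂ))))

lemma auxN0_apply (a b c : ℂ) : auxN0 (a, b, c) = (b, c, 0) := rfl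
lemma auxN1_apply (a b c : ℂ) : auxN1 (a, b, c) = (0, -a, b) := rfl
lemma auxN2_apply (a b c : ℂ) : auxN2 (a, b, c) = (0, 0, b) := rfl

lemma integral_triple (f g h : ℝ → ℂ) (a b : ℝ) (hf : IntervalIntegrable f volume a b)
    (hg : IntervalIntegrable g volume a b) (hh : IntervalIntegrable h volume a b) :
    ∫ t in a..b, (f t, g t, h t) = (∫ t in a..b, f t, ∫ t in a..b, g t, ∫ t in a..b, h t) := by
  have hgh : ∫ t in a..b, (g t, h t) = (∫ t in a..b, g t, ∫ t in a..b, h t) := by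
    simp only [intervalIntegral]
    rw [integral_pair hg.1 hh.1, integral_pair hg.2 hh.2]; rfl
  rw [← hgh]
  simp only [intervalIntegral]
  rw [integral_pair hf.1 (hg.1.prodMk hh.1), integral_pair hf.2 (hg.2.prodMk hh.2)]; rfl

end main

/-- For fixed real initial data, the solution of the third order measure differential
equation and its derivatives are entire functions of the spectral parameter `λ`. -/
theorem solution_entire_in_lambda
    (p q : ℝ → ℝ) (hp : MemM0 p) (hq : MemM0 q)
    (y z w : ℂ → ℝ → ℂ) (y₀ z₀ w₀ : ℝ)
    (hsol : ∀ lam : ℂ, IsSolution p q lam (y lam) (z lam) (w lam))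
    (hinit : ∀ lam : ℂ, y lam 0 = (y₀ : ℂ) ∧ z lam 0 = (z₀ : ℂ) ∧ w lam 0 = (w₀ : ℂ)) :
    ∀ x ∈ Icc (0 : ℝ) 1,
      (∀ l : ℂ, AnalyticAt ℂ (fun lam => y lam x) l) ∧
      (∀ l : ℂ, AnalyticAt ℂ (fun lam => z lam x) l) ∧
      (∀ l : ℂ, AnalyticAt ℂ (fun lam => w lam x) l) := by
  obtain ⟨mp, hmp, hpi, Cp, hCp⟩ := memM0_dom p hp
  obtain ⟨mq, hmq, hqi, Cq, hCq⟩ := memM0_dom q hq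
  have hpC : IntervalIntegrable (fun t => (p t : ℂ)) MeasureTheory.volume 0 1 :=
    ⟨hpi.1.ofReal, hpi.2.ofReal⟩
  have hqC : IntervalIntegrable (fun t => (q t : ℂ)) MeasureTheory.volume 0 1 :=
    ⟨hqi.1.ofReal, hqi.2.ofReal⟩
  have hlinC : IntervalIntegrable (fun t : ℝ => Complex.I * (t:ℂ)) MeasureTheory.volume 0 1 :=
    Continuous.intervalIntegrable (by fun_prop) _ _
  have hmu : ∀ l, IntervalIntegrable (muCoef p q l) MeasureTheory.volume 0 1 := by
    intro l
    refine (hqC.sub (hpC.const_mul Complex.I)).add ?_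
    exact Continuous.intervalIntegrable (by fun_prop) _ _
  have hmu0 : ∀ l, muCoef p q l 0 = 0 := by
    intro l; simp [muCoef, hp.1, hq.1]
  have hRS : ∀ l, ∀ x ∈ Icc (0:ℝ) 1, RSC (y l) (muCoef p q l) 0 x =
      y l x * muCoef p q l x - ∫ t in (0:ℝ)..x, muCoef p q l t * z l t := by
    intro l x hx
    rw [rsc_eq (muCoef p q l) (y l) (z l) (fun t => mq t + mp t + ‖l‖ * t) ?_ (hmu l)
      (hsol l).1 (hsol l).2.1 x hx, hmu0, mul_zero, sub_zero]
    intro s hs t ht hst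
    have e : muCoef p q l t - muCoef p q l s = ((q t - q s : ℝ) : ℂ)
        + (-Complex.I) * ((p t - p s : ℝ) : ℂ) + l * Complex.I * ((t - s : ℝ) : ℂ) := by
      simp only [muCoef]; push_cast; ring
    rw [e]
    refine norm_add₃_le.trans ?_
    simp only [norm_mul, Complex.norm_real, norm_neg, Complex.norm_I, one_mul, mul_one,
      Real.norm_eq_abs]
    rw [abs_of_nonneg (sub_nonneg.2 hst)]
    have := hmp s hs t ht hst
    have := hmq s hs t ht hst
    linarith
  -- the modified second quasi-derivative
  let v : ℂ → ℝ → ℂ := fun l x => w l x + y l x * muCoef p q l x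
  have hzI : ∀ l, ContinuousOn (z l) (uIcc 0 1) := by
    intro l; rw [uIcc_of_le zero_le_one]; exact (hsol l).1
  have hcoef : ∀ l, IntervalIntegrable (fun t => (muCoef p q l t - 2 * (q t : ℂ)) * z l t)
      MeasureTheory.volume 0 1 := fun l =>
    ((hmu l).sub (hqC.const_mul 2)).mul_continuousOn (hzI l)
  have hv : ∀ l, ∀ x ∈ Icc (0:ℝ) 1, v l x = (w₀ : ℂ) +
      ∫ t in (0:ℝ)..x, (muCoef p q l t - 2 * (q t : ℂ)) * z l t := by
    intro l x hx
    rcases eq_or_lt_of_le hx.1 with h0 | h0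
    · subst h0
      simp [v, hmu0, (hinit l).2.2]
    · have i1 := sub_int ((hmu l).mul_continuousOn (hzI l)) (a := 0) (by simp) hx
      have i2 := sub_int ((hqC.const_mul 2).mul_continuousOn (hzI l)) (a := 0) (by simp) hx
      have e : ∫ t in (0:ℝ)..x, (muCoef p q l t - 2 * (q t : ℂ)) * z l t =
          (∫ t in (0:ℝ)..x, muCoef p q l t * z l t) - ∫ t in (0:ℝ)..x, 2 * (q t : ℂ) * z l t := by
        rw [← intervalIntegral.integral_sub i1 i2]
        simp only [sub_mul]
      rw [e]
      simp only [v]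
      rw [(hsol l).2.2.2 x ⟨h0, hx.2⟩, hRS l x hx, (hinit l).2.2]
      ring
  have cprim : ∀ f : ℝ → ℂ, IntervalIntegrable f MeasureTheory.volume 0 1 → ∀ c : ℂ,
      ∀ g : ℝ → ℂ, (∀ x ∈ Icc (0:ℝ) 1, g x = c + ∫ t in (0:ℝ)..x, f t) →
      ContinuousOn g (Icc 0 1) := by
    intro f hf c g hg
    have := intervalIntegral.continuousOn_primitive_interval' hf left_mem_uIcc
    rw [uIcc_of_le (zero_le_one' ℝ)] at this
    exact (this.const_add c).congr hg
  have hvc : ∀ l, ContinuousOn (v l) (Icc 0 1) := fun l => cprim _ (hcoef l) _ _ (hv l)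
  have hyc : ∀ l, ContinuousOn (y l) (Icc 0 1) := fun l =>
    cprim _ (hzI l).intervalIntegrable _ _ (hsol l).2.1
  have hyI : ∀ l, ContinuousOn (y l) (uIcc 0 1) := by
    intro l; rw [uIcc_of_le zero_le_one]; exact hyc l
  have hvI : ∀ l, ContinuousOn (v l) (uIcc 0 1) := by
    intro l; rw [uIcc_of_le zero_le_one]; exact hvc l
  have key := vol_entire
    (fun t => auxN0 + ((q t : ℂ) - Complex.I * (p t : ℂ)) • auxN1 + (-2 * (q t : ℂ)) • auxN2)
    (fun t => (Complex.I * (t : ℂ)) • auxN1)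
    ((intervalIntegrable_const.add
      ((hqC.sub (hpC.const_mul Complex.I)).smul_continuousOn continuousOn_const)).add
      ((hqC.const_mul (-2)).smul_continuousOn continuousOn_const))
    (hlinC.smul_continuousOn continuousOn_const)
    (‖auxN0‖ + (Cq + Cp) * ‖auxN1‖ + (2 * Cq) * ‖auxN2‖) (1 * ‖auxN1‖)
    (by
      intro t ht
      refine norm_add₃_le.trans ?_
      rw [norm_smul, norm_smul]
      have a1 := hCq t ht
      have a2 := hCp t ht
      have b1 : ‖(q t : ℂ) - Complex.I * (p t : ℂ)‖ ≤ Cq + Cp := by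
        refine (norm_sub_le _ _).trans ?_
        simp only [norm_mul, Complex.norm_real, Complex.norm_I, one_mul, Real.norm_eq_abs]
        linarith
      have b2 : ‖(-2 * (q t : ℂ))‖ ≤ 2 * Cq := by
        simp only [norm_mul, norm_neg, Complex.norm_real, Real.norm_eq_abs, Complex.norm_ofNat]
        linarith
      gcongr)
    (by
      intro t ht
      rw [norm_smul]
      have b1 : ‖Complex.I * (t : ℂ)‖ ≤ 1 := by
        simp only [norm_mul, Complex.norm_real, Complex.norm_I, one_mul, Real.norm_eq_abs]
        rw [abs_of_nonneg ht.1]; exact ht.2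
      gcongr)
    ((y₀ : ℂ), (z₀ : ℂ), (w₀ : ℂ)) (fun l x => (y l x, z l x, v l x))
    (fun l => (hyc l).prodMk ((hsol l).1.prodMk (hvc l)))
    (by
      intro l x hx
      have e : ∀ t : ℝ, (auxN0 + ((q t : ℂ) - Complex.I * (p t : ℂ)) • auxN1
          + (-2 * (q t : ℂ)) • auxN2 + l • (Complex.I * (t : ℂ)) • auxN1)
          (y l t, z l t, v l t) = (z l t, w l t, (muCoef p q l t - 2 * (q t : ℂ)) * z l t) := by
        intro t
        simp only [add_apply, smul_apply, auxN0_apply, auxN1_apply, auxN2_apply, Prod.smul_mk,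
          Prod.mk_add_mk, smul_eq_mul, v, muCoef]
        refine Prod.ext ?_ (Prod.ext ?_ ?_) <;> simp only <;> ring
      have hwI : IntervalIntegrable (w l) MeasureTheory.volume 0 1 := by
        have h1 := (hvI l).intervalIntegrable.sub (((hmu l).continuousOn_mul (hyI l)))
        have h2 : w l = fun t => v l t - y l t * muCoef p q l t := by
          funext t; simp [v]
        rw [h2]; exact h1
      simp only [e]
      have m0 : (0:ℝ) ∈ Icc (0:ℝ) 1 := by simp
      rw [integral_triple _ _ _ _ _ (sub_int (hzI l).intervalIntegrable m0 hx)
        (sub_int hwI m0 hx) (sub_int (hcoef l) m0 hx)]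
      refine Prod.ext ?_ (Prod.ext ?_ ?_)
      · simpa [(hinit l).1] using (hsol l).2.1 x hx
      · simpa [(hinit l).2.1] using (hsol l).2.2.1 x hx
      · exact hv l x hx)
  intro x hx
  have hd := key x hx
  have hyd : Differentiable ℂ (fun l => y l x) := hd.fst
  have hzd : Differentiable ℂ (fun l => z l x) := hd.snd.fst
  have hvd : Differentiable ℂ (fun l => v l x) := hd.snd.snd
  have hmud : Differentiable ℂ (fun l => muCoef p q l x) := by
    unfold muCoef; fun_prop
  have hwd : Differentiable ℂ (fun l => w l x) := by
    have h2 : (fun l => w l x) = fun l => v l x - y l x * muCoef p q l x := by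
      funext l; simp [v]
    rw [h2]
    exact hvd.sub (hyd.mul hmud)
  exact ⟨fun l => hyd.analyticAt l, fun l => hzd.analyticAt l, fun l => hwd.analyticAt l⟩
end

section
/- Suppose p_m → p₀ weakly* in M₀([0,1],𝕂), i.e., ∫₀¹ g dp_m → ∫₀¹ g dp₀ for all continuous g. Fix λ ∈ ℂ, q ∈ M₀([0,1],𝕂), and initial data (y₀, z₀, w₀) ∈ 𝕂³, and let y_m denote the solution of i d(y')• + 2iq y' dx + y(i dq + dp_m) = λ y dx with these initial data. Then the sequence {y_m} is relatively compact in (C¹([0,1],ℂ), ‖·‖_∞ + ‖(·)'‖_∞): it is uniformly bounded, equicontinuous, and its derivatives are uniformly bounded and equicontinuous. -/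
open Set Filter Topology

open MeasureTheory

theorem memM0_facts {f : ℝ → ℝ} (hf : MemM0 f) :
    (∃ B : ℝ, 0 ≤ B ∧ ∀ x ∈ Icc (0:ℝ) 1, |f x| ≤ B) ∧
    (∀ᵐ x : ℝ, x ∈ Icc (0:ℝ) 1 → ContinuousWithinAt f (Icc 0 1) x) ∧
    AEStronglyMeasurable f (volume.restrict (Icc (0:ℝ) 1)) := by
  obtain ⟨h0, -, hv⟩ := hf
  have hbv : BoundedVariationOn f (Icc 0 1) := hv
  have hl := hbv.locallyBoundedVariationOn
  refine ⟨⟨(eVariationOn f (Icc 0 1)).toReal, ENNReal.toReal_nonneg, ?_⟩, ?_, ?_⟩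
  · intro x hx
    have := hbv.dist_le hx (left_mem_Icc.2 zero_le_one)
    simpa [h0, Real.dist_eq] using this
  · filter_upwards [hl.ae_differentiableWithinAt_of_mem] with x hx hxs
    exact (hx hxs).continuousWithinAt
  · obtain ⟨p, q, hp, hq, rfl⟩ := hl.exists_monotoneOn_sub_monotoneOn
    exact ((aemeasurable_restrict_of_monotoneOn measurableSet_Icc hp).sub
      (aemeasurable_restrict_of_monotoneOn measurableSet_Icc hq)).aestronglyMeasurable

theorem abel_sum {𝕜 : Type*} [RCLike 𝕜] (G F : ℕ → 𝕜) (n : ℕ) :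
    ∑ i ∈ Finset.range n, G i * (F (i+1) - F i) =
      G n * F n - G 0 * F 0 - ∑ i ∈ Finset.range n, F (i+1) * (G (i+1) - G i) := by
  induction n with
  | zero => simp
  | succ n ih => rw [Finset.sum_range_succ, Finset.sum_range_succ, ih]; ring

theorem rs_tendsto {𝕜 : Type*} [RCLike 𝕜] {f g h : ℝ → 𝕜} {x B : ℝ} (hx : 0 < x)
    (hB : ∀ t ∈ Icc (0:ℝ) x, ‖f t‖ ≤ B)
    (hc : ∀ᵐ t : ℝ, t ∈ Icc (0:ℝ) x → ContinuousWithinAt f (Icc 0 x) t)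
    (hh : IntervalIntegrable h volume 0 x)
    (hg : ∀ s ∈ Icc (0:ℝ) x, g s = g 0 + ∫ t in (0:ℝ)..s, h t) :
    Tendsto (fun n : ℕ => ∑ i ∈ Finset.range n,
      g (0 + (i : ℝ) * (x - 0) / n) *
        (f (0 + ((i : ℝ) + 1) * (x - 0) / n) - f (0 + (i : ℝ) * (x - 0) / n))) atTop
      (𝓝 (g x * f x - g 0 * f 0 - ∫ t in (0:ℝ)..x, f t * h t)) := by
  let s : ℕ → ℕ → ℝ := fun n i => (i : ℝ) * x / n
  let Φ : ℕ → ℝ → 𝕜 := fun n t => f (s n ⌈t * n / x⌉₊) * h t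
  have hs_mem : ∀ n : ℕ, 0 < n → ∀ i ≤ n, s n i ∈ Icc 0 x := by
    intro n hn i hi
    have hn' : (0:ℝ) < n := by exact_mod_cast hn
    have hi' : (i:ℝ) ≤ n := by exact_mod_cast hi
    refine ⟨by positivity, ?_⟩
    show (i:ℝ) * x / n ≤ x
    rw [div_le_iff₀ hn']; nlinarith
  have hceil : ∀ n : ℕ, 0 < n → ∀ t ∈ Ioc 0 x, ⌈t * n / x⌉₊ ≤ n := by
    intro n hn t ht
    rw [Nat.ceil_le, div_le_iff₀ hx]
    have hn' : (0:ℝ) < n := by exact_mod_cast hn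
    nlinarith [ht.2]
  have hlim : Tendsto (fun n => ∫ t in (0:ℝ)..x, Φ n t) atTop
      (𝓝 (∫ t in (0:ℝ)..x, f t * h t)) := by
    refine intervalIntegral.tendsto_integral_filter_of_dominated_convergence
      (fun t => B * ‖h t‖) ?_ ?_ (hh.norm.const_mul B) ?_
    · refine Eventually.of_forall fun n => ?_
      refine AEStronglyMeasurable.mul ?_ ?_
      · have h1 : Measurable (fun k : ℕ => f (s n k)) := measurable_from_nat
        have h2 : Measurable (fun t : ℝ => ⌈t * n / x⌉₊) := by fun_prop
        exact (h1.comp h2).aestronglyMeasurable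
      · exact hh.def'.aestronglyMeasurable
    · filter_upwards [eventually_gt_atTop 0] with n hn
      refine Eventually.of_forall fun t ht => ?_
      rw [uIoc_of_le hx.le] at ht
      rw [norm_mul]
      exact mul_le_mul_of_nonneg_right (hB _ (hs_mem n hn _ (hceil n hn t ht))) (norm_nonneg _)
    · filter_upwards [hc] with t htc ht
      rw [uIoc_of_le hx.le] at ht
      refine Tendsto.mul_const _ ?_
      have hct := htc ⟨ht.1.le, ht.2⟩
      refine hct.tendsto.comp ?_
      rw [tendsto_nhdsWithin_iff]
      constructor
      · have hu : Tendsto (fun n : ℕ => t + x / n) atTop (𝓝 t) := by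
          simpa using (tendsto_const_nhds (x := t)).add (tendsto_const_div_atTop_nhds_zero_nat x)
        refine tendsto_of_tendsto_of_tendsto_of_le_of_le' tendsto_const_nhds hu ?_ ?_
        · filter_upwards [eventually_gt_atTop 0] with n hn
          have hn' : (0:ℝ) < n := by exact_mod_cast hn
          have := Nat.le_ceil (t * n / x)
          show t ≤ (⌈t * n / x⌉₊ : ℝ) * x / n
          rw [le_div_iff₀ hn']
          rwa [div_le_iff₀ hx] at this
        · filter_upwards [eventually_gt_atTop 0] with n hn
          have hn' : (0:ℝ) < n := by exact_mod_cast hn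
          have := (Nat.ceil_lt_add_one (a := t * n / x) (by have := ht.1; positivity)).le
          show (⌈t * n / x⌉₊ : ℝ) * x / n ≤ t + x / n
          rw [div_le_iff₀ hn']
          calc (⌈t * n / x⌉₊ : ℝ) * x ≤ (t * n / x + 1) * x := by gcongr
            _ = (t + x / n) * n := by field_simp
      · filter_upwards [eventually_gt_atTop 0] with n hn
        exact hs_mem n hn _ (hceil n hn t ht)
  have hsum : ∀ᶠ n : ℕ in atTop, g x * f x - g 0 * f 0 - ∫ t in (0:ℝ)..x, Φ n t =
      ∑ i ∈ Finset.range n, g (0 + (i : ℝ) * (x - 0) / n) *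
        (f (0 + ((i : ℝ) + 1) * (x - 0) / n) - f (0 + (i : ℝ) * (x - 0) / n)) := by
    filter_upwards [eventually_gt_atTop 0] with n hn
    have hn' : (0:ℝ) < n := by exact_mod_cast hn
    have e1 : ∑ i ∈ Finset.range n, g (0 + (i : ℝ) * (x - 0) / n) *
        (f (0 + ((i : ℝ) + 1) * (x - 0) / n) - f (0 + (i : ℝ) * (x - 0) / n)) =
        ∑ i ∈ Finset.range n, g (s n i) * (f (s n (i+1)) - f (s n i)) := by
      refine Finset.sum_congr rfl fun i _ => ?_
      simp [s]
    have s0 : s n 0 = 0 := by simp [s]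
    have sn : s n n = x := by simp only [s]; field_simp
    rw [e1, abel_sum (fun i => g (s n i)) (fun i => f (s n i)), s0, sn]
    congr 1
    have hmono : ∀ i, s n i ≤ s n (i+1) := by
      intro i; simp only [s]; push_cast; gcongr; linarith
    have hsub : ∀ i < n, IntervalIntegrable h volume (s n i) (s n (i+1)) := by
      intro i hi
      refine hh.mono_set ?_
      rw [uIcc_of_le (hmono i), uIcc_of_le hx.le]
      exact Icc_subset_Icc (hs_mem n hn i hi.le).1 (hs_mem n hn (i+1) hi).2
    have hae : ∀ i, ∀ t ∈ Ioc (s n i) (s n (i+1)), Φ n t = f (s n (i+1)) * h t := by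
      intro i t ht
      have : ⌈t * n / x⌉₊ = i + 1 := by
        rw [Nat.ceil_eq_iff (by omega)]
        have h1 := ht.1
        have h2 := ht.2
        simp only [s] at h1 h2
        rw [div_lt_iff₀ hn'] at h1
        rw [le_div_iff₀ hn'] at h2
        constructor
        · rw [lt_div_iff₀ hx]; simpa using h1
        · rw [div_le_iff₀ hx]; simpa using h2
      simp only [Φ, this]
    have e2 : ∀ i < n, ∫ t in (s n i)..(s n (i+1)), Φ n t =
        f (s n (i+1)) * (g (s n (i+1)) - g (s n i)) := by
      intro i hi
      rw [hg _ (hs_mem n hn i hi.le), hg _ (hs_mem n hn (i+1) hi)]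
      rw [add_sub_add_left_eq_sub, intervalIntegral.integral_interval_sub_left,
        ← intervalIntegral.integral_const_mul]
      · refine intervalIntegral.integral_congr_ae (Eventually.of_forall fun t ht => ?_)
        rw [uIoc_of_le (hmono i)] at ht
        exact hae i t ht
      all_goals
        refine hh.mono_set ?_
        rw [uIcc_of_le hx.le]
      · rw [uIcc_of_le (hs_mem n hn (i+1) hi).1]
        exact Icc_subset_Icc le_rfl (hs_mem n hn (i+1) hi).2
      · rw [uIcc_of_le (hs_mem n hn i hi.le).1]
        exact Icc_subset_Icc le_rfl (hs_mem n hn i hi.le).2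
    have e3 := intervalIntegral.sum_integral_adjacent_intervals (f := Φ n) (μ := volume)
      (a := s n) (n := n) (fun i hi => by
        refine ((hsub i hi).const_mul (f (s n (i+1)))).congr ?_
        intro t ht
        rw [uIoc_of_le (hmono i)] at ht
        exact (hae i t ht).symm)
    rw [s0, sn] at e3
    rw [← e3]
    exact Finset.sum_congr rfl fun i hi => e2 i (Finset.mem_range.1 hi)
  exact (tendsto_const_nhds.sub hlim).congr' hsum

theorem RS_eq {f g h : ℝ → ℝ} (hf : MemM0 f) (hh : IntervalIntegrable h volume 0 1)
    (hg : ∀ s ∈ Icc (0:ℝ) 1, g s = g 0 + ∫ t in (0:ℝ)..s, h t) :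
    RS g f 0 1 = g 1 * f 1 - ∫ t in (0:ℝ)..1, f t * h t := by
  obtain ⟨⟨B, -, hB⟩, hc, -⟩ := memM0_facts hf
  have := (rs_tendsto (𝕜 := ℝ) zero_lt_one hB hc hh hg).limUnder_eq
  rw [hf.1] at this
  simpa [RS] using this

theorem integrable_mul_M0 {f : ℝ → ℝ} (hf : MemM0 f) {h : ℝ → ℝ}
    (hh : Integrable h (volume.restrict (Ioc (0:ℝ) 1))) :
    Integrable (fun t => f t * h t) (volume.restrict (Ioc (0:ℝ) 1)) := by
  obtain ⟨⟨B, -, hB⟩, -, hm⟩ := memM0_facts hf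
  refine hh.bdd_mul (c := B) (hm.mono_measure (Measure.restrict_mono Ioc_subset_Icc_self le_rfl)) ?_
  filter_upwards [ae_restrict_mem measurableSet_Ioc] with x hx
  exact hB x (Ioc_subset_Icc_self hx)

theorem exists_CLM {f : ℝ → ℝ} (hf : MemM0 f) :
    ∃ T : Lp ℝ 1 (volume.restrict (Ioc (0:ℝ) 1)) →L[ℝ] ℝ,
      ∀ h, T h = ∫ t in Ioc (0:ℝ) 1, f t * h t := by
  obtain ⟨⟨B, hB0, hB⟩, -, hm⟩ := memM0_facts hf
  refine ⟨LinearMap.mkContinuous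
    { toFun := fun h => ∫ t in Ioc (0:ℝ) 1, f t * h t
      map_add' := ?_
      map_smul' := ?_ } B ?_, fun h => rfl⟩
  · intro h k
    rw [← integral_add (integrable_mul_M0 hf (L1.integrable_coeFn h))
      (integrable_mul_M0 hf (L1.integrable_coeFn k))]
    refine integral_congr_ae ?_
    filter_upwards [Lp.coeFn_add h k] with t ht
    rw [ht, Pi.add_apply, mul_add]
  · intro c h
    rw [RingHom.id_apply, smul_eq_mul, ← integral_const_mul]
    refine integral_congr_ae ?_
    filter_upwards [Lp.coeFn_smul c h] with t ht
    rw [ht, Pi.smul_apply, smul_eq_mul]; ring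
  · intro h
    show ‖∫ t in Ioc (0:ℝ) 1, f t * h t‖ ≤ _
    rw [L1.norm_eq_integral_norm, ← integral_const_mul]
    refine norm_integral_le_of_norm_le ((L1.integrable_coeFn h).norm.const_mul B) ?_
    filter_upwards [ae_restrict_mem measurableSet_Ioc] with x hx
    rw [norm_mul]
    exact mul_le_mul_of_nonneg_right (hB x (Ioc_subset_Icc_self hx)) (norm_nonneg _)

theorem uniform_bound (p : ℕ → ℝ → ℝ) (p0 : ℝ → ℝ) (hpm : ∀ m, MemM0 (p m))
    (hweak : ∀ g : ℝ → ℝ, Continuous g →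
      Tendsto (fun m => RS g (p m) 0 1) atTop (𝓝 (RS g p0 0 1))) :
    ∃ P : ℝ, 0 ≤ P ∧ ∀ m, ∀ᵐ x ∂(volume.restrict (Ioc (0:ℝ) 1)), |p m x| ≤ P := by
  choose T hT using fun m => exists_CLM (hpm m)
  have h1 : ∀ m, RS (fun _ => 1) (p m) 0 1 = p m 1 := by
    intro m
    rw [RS_eq (hpm m) (h := fun _ => 0) (by simp) (by simp)]
    simp
  have hp1 : Tendsto (fun m => p m 1) atTop (𝓝 (RS (fun _ => 1) p0 0 1)) := by
    simpa [h1] using hweak (fun _ => 1) continuous_const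
  obtain ⟨C, hC⟩ := banach_steinhaus (g := T) (by
    intro h
    have hi : Integrable ((Ioc (0:ℝ) 1).indicator h) :=
      (integrable_indicator_iff measurableSet_Ioc).2 (L1.integrable_coeFn h)
    let g : ℝ → ℝ := fun s => ∫ t in (0:ℝ)..s, (Ioc (0:ℝ) 1).indicator h t
    have hgc : Continuous g :=
      intervalIntegral.continuous_primitive (fun a b => hi.intervalIntegrable) 0
    have e : ∀ m, T m h = g 1 * p m 1 - RS g (p m) 0 1 := by
      intro m
      rw [RS_eq (hpm m) (h := (Ioc (0:ℝ) 1).indicator h) hi.intervalIntegrable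
        (by intro s _; simp [g]), hT]
      rw [sub_sub_cancel, intervalIntegral.integral_of_le zero_le_one]
      refine setIntegral_congr_fun measurableSet_Ioc fun t ht => ?_
      simp [indicator_of_mem ht]
    have ht : Tendsto (fun m => T m h) atTop
        (𝓝 (g 1 * RS (fun _ => 1) p0 0 1 - RS g p0 0 1)) := by
      simp only [e]
      exact (hp1.const_mul _).sub (hweak g hgc)
    obtain ⟨C, hC⟩ := (Metric.isBounded_range_of_tendsto _ ht).exists_norm_le
    exact ⟨C, fun i => hC _ (mem_range_self i)⟩)
  refine ⟨C, (norm_nonneg _).trans (hC 0), fun m => ?_⟩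
  have hint : Integrable (p m) (volume.restrict (Ioc (0:ℝ) 1)) := by
    simpa using integrable_mul_M0 (hpm m) (h := fun _ => 1) (integrable_const _)
  have key : ∀ s, MeasurableSet s →
      |∫ x in s, p m x ∂(volume.restrict (Ioc (0:ℝ) 1))| ≤
        ∫ x in s, C ∂(volume.restrict (Ioc (0:ℝ) 1)) := by
    intro s hs
    have hfin : (volume.restrict (Ioc (0:ℝ) 1)) s ≠ ⊤ := measure_ne_top _ _
    have h2 := (T m).le_of_opNorm_le (hC m) (indicatorConstLp 1 hs hfin (1:ℝ))
    rw [hT, norm_indicatorConstLp one_ne_zero ENNReal.one_ne_top] at h2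
    have h3 : ∫ t in Ioc (0:ℝ) 1, p m t * (indicatorConstLp 1 hs hfin (1:ℝ) : _ → ℝ) t =
        ∫ x in s, p m x ∂(volume.restrict (Ioc (0:ℝ) 1)) := by
      rw [← integral_indicator hs]
      refine integral_congr_ae ?_
      filter_upwards [indicatorConstLp_coeFn (p := 1) (hs := hs) (hμs := hfin) (c := (1:ℝ))]
        with t ht
      rw [ht]
      by_cases hts : t ∈ s <;> simp [hts]
    rw [h3] at h2
    rw [setIntegral_const, smul_eq_mul, mul_comm]
    simpa using h2
  have a1 := ae_le_of_forall_setIntegral_le hint (integrable_const C)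
    (fun s hs _ => (le_abs_self _).trans (key s hs))
  have a2 := ae_le_of_forall_setIntegral_le hint.neg (integrable_const C)
    (fun s hs _ => by
      simp only [Pi.neg_apply, integral_neg]
      exact (neg_le_abs _).trans (key s hs))
  filter_upwards [a1, a2] with x h1 h2
  exact abs_le.2 ⟨by simp only [Pi.neg_apply] at h2; linarith, h1⟩

theorem muCoef_facts {p q : ℝ → ℝ} (hp : MemM0 p) (hq : MemM0 q) (lam : ℂ) :
    muCoef p q lam 0 = 0 ∧
    (∃ B : ℝ, ∀ x ∈ Icc (0:ℝ) 1, ‖muCoef p q lam x‖ ≤ B) ∧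
    (∀ᵐ x : ℝ, x ∈ Icc (0:ℝ) 1 → ContinuousWithinAt (muCoef p q lam) (Icc 0 1) x) ∧
    AEStronglyMeasurable (muCoef p q lam) (volume.restrict (Icc (0:ℝ) 1)) ∧
    (∀ x ∈ Icc (0:ℝ) 1, ‖muCoef p q lam x‖ ≤ |q x| + |p x| + ‖lam‖) := by
  obtain ⟨⟨B, hB0, hB⟩, hpc, hpm⟩ := memM0_facts hp
  obtain ⟨⟨Q, hQ0, hQ⟩, hqc, hqm⟩ := memM0_facts hq
  have hb : ∀ x ∈ Icc (0:ℝ) 1, ‖muCoef p q lam x‖ ≤ |q x| + |p x| + ‖lam‖ := by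
    intro x hx
    unfold muCoef
    refine (norm_add_le _ _).trans (add_le_add ((norm_sub_le _ _).trans ?_) ?_)
    · simp
    · simp only [norm_mul, Complex.norm_I, mul_one, Complex.norm_real, Real.norm_eq_abs]
      have : |x| ≤ 1 := abs_le.2 ⟨by linarith [hx.1], hx.2⟩
      nlinarith [norm_nonneg lam]
  refine ⟨by simp [muCoef, hp.1, hq.1], ⟨Q + B + ‖lam‖, fun x hx => (hb x hx).trans ?_⟩,
    ?_, ?_, hb⟩
  · linarith [hB x hx, hQ x hx]
  · filter_upwards [hpc, hqc] with x h1 h2 hx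
    unfold muCoef
    refine ContinuousWithinAt.add (ContinuousWithinAt.sub ?_ ?_) ?_
    · exact Complex.continuous_ofReal.continuousAt.comp_continuousWithinAt (h2 hx)
    · exact continuousWithinAt_const.mul
        (Complex.continuous_ofReal.continuousAt.comp_continuousWithinAt (h1 hx))
    · exact (by fun_prop : Continuous fun t : ℝ => lam * Complex.I * (t:ℂ)).continuousWithinAt
  · unfold muCoef
    refine AEStronglyMeasurable.add (AEStronglyMeasurable.sub ?_ ?_) ?_
    · exact Complex.continuous_ofReal.comp_aestronglyMeasurable hqm
    · exact (Complex.continuous_ofReal.comp_aestronglyMeasurable hpm).const_mul _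
    · exact (by fun_prop : Continuous fun t : ℝ => lam * Complex.I * (t:ℂ)).aestronglyMeasurable

theorem sol_bound {p q : ℝ → ℝ} {lam : ℂ} {y z w : ℝ → ℂ} (hp : MemM0 p) (hq : MemM0 q)
    (hsol : IsSolution p q lam y z w) {Q M A K : ℝ} (hQ0 : 0 ≤ Q) (hM0 : 0 ≤ M)
    (hQ : ∀ x ∈ Icc (0:ℝ) 1, |q x| ≤ Q)
    (hM : ∀ᵐ x ∂(volume.restrict (Ioc (0:ℝ) 1)), ‖muCoef p q lam x‖ ≤ M)
    (hA : A = ‖w 0‖ + M * ‖y 0‖) (hK : K = 2 * Q + 2 * M) {V : ℝ}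
    (hV : V = gronwallBound 0 K (‖z 0‖ + A) 1) :
    (∀ x ∈ Icc (0:ℝ) 1, ‖y x‖ ≤ ‖y 0‖ + V ∧ ‖z x‖ ≤ ‖z 0‖ + A + K * V) ∧
    (∀ x ∈ Icc (0:ℝ) 1, ∀ x' ∈ Icc (0:ℝ) 1,
      ‖y x - y x'‖ ≤ (‖z 0‖ + A + K * V) * |x - x'| ∧ ‖z x - z x'‖ ≤ (A + K * V) * |x - x'|) := by
  obtain ⟨hz, hy, hzw, hw⟩ := hsol
  obtain ⟨hμ0, ⟨B, hB⟩, hμc, hμm, -⟩ := muCoef_facts hp hq lam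
  obtain ⟨-, -, hqm⟩ := memM0_facts hq
  set μ := muCoef p q lam with hμdef
  have hA0 : 0 ≤ A := by rw [hA]; positivity
  have hK0 : 0 ≤ K := by rw [hK]; positivity
  rw [ae_restrict_iff' measurableSet_Ioc] at hM
  -- continuous extension of `z`
  let Z : ℝ → ℂ := fun t => z (projIcc (0:ℝ) 1 zero_le_one t)
  have hZc : Continuous Z := hz.comp_continuous
    (continuous_subtype_val.comp continuous_projIcc) (fun t => (projIcc (0:ℝ) 1 zero_le_one t).2)
  have hZz : ∀ t ∈ Icc (0:ℝ) 1, Z t = z t := by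
    intro t ht
    simp only [Z]
    rw [projIcc_of_mem zero_le_one ht]
  let v : ℝ → ℝ := fun x => ∫ t in (0:ℝ)..x, ‖Z t‖
  have hvd : ∀ x, HasDerivAt v ‖Z x‖ x := fun x =>
    intervalIntegral.integral_hasDerivAt_right (hZc.norm.intervalIntegrable _ _)
      hZc.norm.aestronglyMeasurable.stronglyMeasurableAtFilter hZc.norm.continuousAt
  have hv0 : v 0 = 0 := by simp [v]
  have hvmono : Monotone v := monotone_of_deriv_nonneg (fun x => (hvd x).differentiableAt)
    (fun x => by rw [(hvd x).deriv]; positivity)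
  have hvc : Continuous v := continuous_iff_continuousAt.2 fun x => (hvd x).continuousAt
  have hvnn : ∀ x, 0 ≤ x → 0 ≤ v x := fun x hx => hv0 ▸ hvmono hx
  have hyZ : ∀ x ∈ Icc (0:ℝ) 1, y x = y 0 + ∫ t in (0:ℝ)..x, Z t := by
    intro x hx
    rw [hy x hx]
    congr 1
    refine intervalIntegral.integral_congr fun t ht => ?_
    rw [uIcc_of_le hx.1] at ht
    exact (hZz t ⟨ht.1, ht.2.trans hx.2⟩).symm
  have hyb : ∀ x ∈ Icc (0:ℝ) 1, ‖y x‖ ≤ ‖y 0‖ + v x := by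
    intro x hx
    rw [hyZ x hx]
    exact (norm_add_le _ _).trans
      (add_le_add_right (intervalIntegral.norm_integral_le_integral_norm hx.1) _)
  -- integrability
  have hmono : volume.restrict (Ioc (0:ℝ) 1) ≤ volume.restrict (Icc (0:ℝ) 1) :=
    Measure.restrict_mono Ioc_subset_Icc_self le_rfl
  have hZint : Integrable Z (volume.restrict (Ioc (0:ℝ) 1)) :=
    (intervalIntegrable_iff_integrableOn_Ioc_of_le zero_le_one).1 (hZc.intervalIntegrable 0 1)
  have hqZ : IntervalIntegrable (fun t => 2 * (q t : ℂ) * Z t) volume 0 1 := by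
    rw [intervalIntegrable_iff_integrableOn_Ioc_of_le zero_le_one]
    refine hZint.bdd_mul (c := 2 * Q) ?_ ?_
    · exact ((Complex.continuous_ofReal.comp_aestronglyMeasurable hqm).const_mul _).mono_measure
        hmono
    · filter_upwards [ae_restrict_mem measurableSet_Ioc] with x hx
      simpa using hQ x (Ioc_subset_Icc_self hx)
  have hμZ : IntervalIntegrable (fun t => μ t * Z t) volume 0 1 := by
    rw [intervalIntegrable_iff_integrableOn_Ioc_of_le zero_le_one]
    refine hZint.bdd_mul (c := B) (hμm.mono_measure hmono) ?_
    filter_upwards [ae_restrict_mem measurableSet_Ioc] with x hx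
    exact hB x (Ioc_subset_Icc_self hx)
  -- formula for `w`
  let W : ℝ → ℂ := fun x => w 0 - (∫ t in (0:ℝ)..x, 2 * (q t : ℂ) * Z t) -
    ((y 0 + ∫ t in (0:ℝ)..x, Z t) * μ x - ∫ t in (0:ℝ)..x, μ t * Z t)
  have hwW : ∀ x ∈ Ioc (0:ℝ) 1, w x = W x := by
    intro x hx
    have hsub : Icc 0 x ⊆ Icc (0:ℝ) 1 := Icc_subset_Icc le_rfl hx.2
    have h1 := (rs_tendsto (𝕜 := ℂ) (f := μ) (g := y) (h := Z) hx.1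
      (fun t ht => hB t (hsub ht))
      (by
        filter_upwards [hμc] with t ht hts
        exact (ht (hsub hts)).mono hsub)
      (hZc.intervalIntegrable _ _) (fun s hs => hyZ s (hsub hs))).limUnder_eq
    have h2 : RSC y μ 0 x = y x * μ x - y 0 * μ 0 - ∫ t in (0:ℝ)..x, μ t * Z t := by
      rw [← h1]; rfl
    rw [hw x hx, h2, hμ0, hyZ x ⟨hx.1.le, hx.2⟩]
    simp only [W, mul_zero, sub_zero]
    congr 2
    refine intervalIntegral.integral_congr fun t ht => ?_
    rw [uIcc_of_le hx.1.le] at ht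
    simp only [hZz t (hsub ht)]
  have hzW : ∀ x ∈ Icc (0:ℝ) 1, z x = z 0 + ∫ t in (0:ℝ)..x, W t := by
    intro x hx
    rw [hzw x hx]
    congr 1
    refine intervalIntegral.integral_congr_ae (Eventually.of_forall fun t ht => ?_)
    rw [uIoc_of_le hx.1] at ht
    exact hwW t ⟨ht.1, ht.2.trans hx.2⟩
  have hWb : ∀ᵐ x, x ∈ Ioc (0:ℝ) 1 → ‖W x‖ ≤ A + K * v x := by
    filter_upwards [hM] with x hMx hx
    have b1 : ‖∫ t in (0:ℝ)..x, 2 * (q t : ℂ) * Z t‖ ≤ 2 * Q * v x := by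
      rw [← intervalIntegral.integral_const_mul]
      refine intervalIntegral.norm_integral_le_of_norm_le hx.1.le
        (Eventually.of_forall fun t ht => ?_) ((hZc.norm.intervalIntegrable _ _).const_mul _)
      rw [norm_mul]
      refine mul_le_mul_of_nonneg_right ?_ (norm_nonneg _)
      simpa using hQ t ⟨ht.1.le, ht.2.trans hx.2⟩
    have b2 : ‖∫ t in (0:ℝ)..x, μ t * Z t‖ ≤ M * v x := by
      rw [← intervalIntegral.integral_const_mul]
      refine intervalIntegral.norm_integral_le_of_norm_le hx.1.le
        ?_ ((hZc.norm.intervalIntegrable _ _).const_mul _)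
      filter_upwards [hM] with t hMt ht
      rw [norm_mul]
      exact mul_le_mul_of_nonneg_right (hMt ⟨ht.1, ht.2.trans hx.2⟩) (norm_nonneg _)
    have b3 : ‖(y 0 + ∫ t in (0:ℝ)..x, Z t) * μ x‖ ≤ (‖y 0‖ + v x) * M := by
      have hx' : x ∈ Icc (0:ℝ) 1 := ⟨hx.1.le, hx.2⟩
      rw [← hyZ x hx', norm_mul]
      have := hvnn x hx'.1
      exact mul_le_mul (hyb x hx') (hMx hx) (norm_nonneg _) (by positivity)
    calc ‖W x‖ ≤ ‖w 0 - (∫ t in (0:ℝ)..x, 2 * (q t : ℂ) * Z t)‖ +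
          ‖(y 0 + ∫ t in (0:ℝ)..x, Z t) * μ x - ∫ t in (0:ℝ)..x, μ t * Z t‖ := norm_sub_le _ _
      _ ≤ (‖w 0‖ + 2 * Q * v x) + ((‖y 0‖ + v x) * M + M * v x) :=
        add_le_add ((norm_sub_le _ _).trans (add_le_add le_rfl b1))
          ((norm_sub_le _ _).trans (add_le_add b3 b2))
      _ = A + K * v x := by rw [hA, hK]; ring
  -- first estimate
  have hzb : ∀ x ∈ Icc (0:ℝ) 1, ‖z x‖ ≤ K * v x + (‖z 0‖ + A) := by
    intro x hx
    have h1 : ‖∫ t in (0:ℝ)..x, W t‖ ≤ ∫ t in (0:ℝ)..x, (A + K * v x) := by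
      refine intervalIntegral.norm_integral_le_of_norm_le hx.1 ?_ (by simp)
      filter_upwards [hWb] with t ht hts
      refine (ht ⟨hts.1, hts.2.trans hx.2⟩).trans ?_
      have := hvmono hts.2
      gcongr
    rw [intervalIntegral.integral_const, smul_eq_mul, sub_zero] at h1
    have h2 : 0 ≤ A + K * v x := by have := hvnn x hx.1; positivity
    rw [hzW x hx]
    refine (norm_add_le _ _).trans ?_
    nlinarith [hx.2]
  have hvV : ∀ x ∈ Icc (0:ℝ) 1, v x ≤ V := by
    intro x hx
    have h := norm_le_gronwallBound_of_norm_deriv_right_le (f := v) (f' := fun x => ‖Z x‖)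
      (δ := 0) (K := K) (ε := ‖z 0‖ + A) (a := 0) (b := 1) hvc.continuousOn
      (fun x _ => (hvd x).hasDerivWithinAt) (by simp [hv0])
      (fun x hx => by
        have hx' : x ∈ Icc (0:ℝ) 1 := Ico_subset_Icc_self hx
        rw [norm_norm, hZz x hx', Real.norm_of_nonneg (hvnn x hx.1)]
        exact hzb x hx') x hx
    rw [hV]
    refine (le_abs_self _).trans (h.trans ?_)
    exact gronwallBound_mono le_rfl (by positivity) hK0 (by linarith [hx.2])
  have hzV : ∀ x ∈ Icc (0:ℝ) 1, ‖z x‖ ≤ ‖z 0‖ + A + K * V := by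
    intro x hx
    have := mul_le_mul_of_nonneg_left (hvV x hx) hK0
    linarith [hzb x hx]
  refine ⟨fun x hx => ⟨(hyb x hx).trans (add_le_add le_rfl (hvV x hx)), hzV x hx⟩, ?_⟩
  have hWint : IntervalIntegrable W volume 0 1 := by
    rw [intervalIntegrable_iff_integrableOn_Ioc_of_le zero_le_one]
    have hcont : ∀ {F : ℝ → ℂ}, IntervalIntegrable F volume 0 1 →
        AEStronglyMeasurable (fun x => ∫ t in (0:ℝ)..x, F t) (volume.restrict (Ioc (0:ℝ) 1)) := by
      intro F hF
      have := intervalIntegral.continuousOn_primitive_interval' hF left_mem_uIcc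
      rw [uIcc_of_le zero_le_one] at this
      exact (this.mono Ioc_subset_Icc_self).aestronglyMeasurable measurableSet_Ioc
    have hWm : AEStronglyMeasurable W (volume.restrict (Ioc (0:ℝ) 1)) := by
      refine (aestronglyMeasurable_const.sub (hcont hqZ)).sub
        (((aestronglyMeasurable_const.add (hcont (hZc.intervalIntegrable 0 1))).mul
          (hμm.mono_measure hmono)).sub (hcont hμZ))
    refine Integrable.of_bound hWm (A + K * V) ?_
    rw [ae_restrict_iff' measurableSet_Ioc]
    filter_upwards [hWb] with x h hx
    have := mul_le_mul_of_nonneg_left (hvV x (Ioc_subset_Icc_self hx)) hK0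
    linarith [h hx]
  have hsubint : ∀ {F : ℝ → ℂ}, IntervalIntegrable F volume 0 1 → ∀ x ∈ Icc (0:ℝ) 1,
      IntervalIntegrable F volume 0 x := by
    intro F hF x hx
    refine hF.mono_set ?_
    rw [uIcc_of_le zero_le_one, uIcc_of_le hx.1]
    exact Icc_subset_Icc le_rfl hx.2
  intro x hx x' hx'
  have hIoc : uIoc x' x ⊆ Ioc (0:ℝ) 1 := Ioc_subset_Ioc (le_min hx'.1 hx.1) (max_le hx'.2 hx.2)
  constructor
  · rw [hyZ x hx, hyZ x' hx', add_sub_add_left_eq_sub,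
      intervalIntegral.integral_interval_sub_left (hZc.intervalIntegrable _ _)
        (hZc.intervalIntegrable _ _)]
    refine intervalIntegral.norm_integral_le_of_norm_le_const fun t ht => ?_
    have ht' := Ioc_subset_Icc_self (hIoc ht)
    rw [hZz t ht']
    exact hzV t ht'
  · rw [hzW x hx, hzW x' hx', add_sub_add_left_eq_sub,
      intervalIntegral.integral_interval_sub_left (hsubint hWint x hx) (hsubint hWint x' hx')]
    refine intervalIntegral.norm_integral_le_of_norm_le_const_ae ?_
    filter_upwards [hWb] with t h ht
    have ht' := hIoc ht
    have := mul_le_mul_of_nonneg_left (hvV t (Ioc_subset_Icc_self ht')) hK0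
    linarith [h ht']

theorem equi_of_lip {F : ℕ → ℝ → ℂ} {L : ℝ}
    (h : ∀ m, ∀ x ∈ Icc (0:ℝ) 1, ∀ x' ∈ Icc (0:ℝ) 1, ‖F m x - F m x'‖ ≤ L * |x - x'|) :
    EquicontinuousOn F (Icc 0 1) := by
  refine (LipschitzOnWith.uniformEquicontinuousOn F L.toNNReal fun m => ?_).equicontinuousOn
  refine LipschitzOnWith.of_dist_le_mul fun x hx x' hx' => ?_
  rw [dist_eq_norm, Real.dist_eq]
  refine (h m x hx x' hx').trans ?_
  exact mul_le_mul_of_nonneg_right (Real.le_coe_toNNReal L) (abs_nonneg _)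

/-- If `p_m → p₀` weakly* in `M₀([0,1],𝕂)`, the corresponding solutions `y_m` (with fixed
initial data) form a relatively compact family in `C¹([0,1],ℂ)`: they are uniformly
bounded and equicontinuous, together with their derivatives. -/
theorem solutions_relatively_compact_C1
    (q : ℝ → ℝ) (hq : MemM0 q) (lam : ℂ)
    (p : ℕ → ℝ → ℝ) (p0 : ℝ → ℝ) (hpm : ∀ m, MemM0 (p m)) (hp0 : MemM0 p0)
    (hweak : ∀ g : ℝ → ℝ, Continuous g →
      Tendsto (fun m => RS g (p m) 0 1) atTop (𝓝 (RS g p0 0 1)))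
    (y z w : ℕ → ℝ → ℂ) (y₀ z₀ w₀ : ℂ)
    (hsol : ∀ m, IsSolution (p m) q lam (y m) (z m) (w m))
    (hinit : ∀ m, y m 0 = y₀ ∧ z m 0 = z₀ ∧ w m 0 = w₀) :
    (∃ C : ℝ, ∀ m, ∀ x ∈ Icc (0 : ℝ) 1, ‖y m x‖ ≤ C ∧ ‖z m x‖ ≤ C) ∧
    EquicontinuousOn y (Icc 0 1) ∧ EquicontinuousOn z (Icc 0 1) := by
  obtain ⟨P, hP0, hP⟩ := uniform_bound p p0 hpm hweak
  obtain ⟨⟨Q, hQ0, hQ⟩, -, -⟩ := memM0_facts hq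
  have hM : ∀ m, ∀ᵐ x ∂(volume.restrict (Ioc (0:ℝ) 1)),
      ‖muCoef (p m) q lam x‖ ≤ Q + P + ‖lam‖ := by
    intro m
    filter_upwards [hP m, ae_restrict_mem measurableSet_Ioc] with x h1 h2
    have h3 := Ioc_subset_Icc_self h2
    have := (muCoef_facts (hpm m) hq lam).2.2.2.2 x h3
    linarith [hQ x h3]
  have key := fun m => sol_bound (hpm m) hq (hsol m) hQ0
    (by positivity : 0 ≤ Q + P + ‖lam‖) hQ (hM m) rfl rfl rfl
  simp only [(hinit _).1, (hinit _).2.1, (hinit _).2.2] at key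
  refine ⟨⟨_, fun m x hx => ⟨((key m).1 x hx).1.trans (le_max_left _ _),
    ((key m).1 x hx).2.trans (le_max_right _ _)⟩⟩,
    equi_of_lip fun m x hx x' hx' => ((key m).2 x hx x' hx').1,
    equi_of_lip fun m x hx x' hx' => ((key m).2 x hx x' hx').2⟩
end

section
/- Fix λ ∈ ℂ, q ∈ M₀([0,1],𝕂), initial data in 𝕂³, and let y(·,λ,p,q) be the solution of the third order measure differential equation i d(y')• + 2iq y' dx + y(i dq + dp) = λ y dx. If p_m → p₀ in the weak* topology of M₀([0,1],𝕂), then y(·,λ,p_m,q) → y(·,λ,p₀,q) in C¹([0,1],ℂ), i.e., both ‖y(·,λ,p_m,q) − y(·,λ,p₀,q)‖_∞ → 0 and ‖y'(·,λ,p_m,q) − y'(·,λ,p₀,q)‖_∞ → 0. -/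
open Set Filter Topology

noncomputable def rsS {𝕜 : Type*} [RCLike 𝕜] (g f : ℝ → 𝕜) (b : ℝ) (n : ℕ) : 𝕜 :=
  ∑ i ∈ Finset.range n,
      g (0 + (i : ℝ) * (b - 0) / n) *
        (f (0 + ((i : ℝ) + 1) * (b - 0) / n) - f (0 + (i : ℝ) * (b - 0) / n))

lemma RS_eq_s18 (g f : ℝ → ℝ) (b l : ℝ) (h : Tendsto (rsS g f b) atTop (𝓝 l)) : RS g f 0 b = l :=
  h.limUnder_eq

lemma RSC_eq (g f : ℝ → ℂ) (b : ℝ) (l : ℂ) (h : Tendsto (rsS g f b) atTop (𝓝 l)) :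
    RSC g f 0 b = l :=
  h.limUnder_eq

lemma rsS_tendsto {𝕜 : Type*} [RCLike 𝕜] (g f h : ℝ → 𝕜) (V : ℝ → ℝ) (x C : ℝ) (hx : 0 ≤ x)
    (hV : ∀ s t, 0 ≤ s → s ≤ t → t ≤ x → ‖f t - f s‖ ≤ V t - V s)
    (hh : IntervalIntegrable h MeasureTheory.volume 0 x)
    (hhf : IntervalIntegrable (fun t => h t * f t) MeasureTheory.volume 0 x)
    (hC : ∀ t ∈ Icc 0 x, ‖h t‖ ≤ C)
    (hg : ∀ t ∈ Icc 0 x, g t = g 0 + ∫ s in (0:ℝ)..t, h s) :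
    Tendsto (rsS g f x) atTop (𝓝 (g x * f x - g 0 * f 0 - ∫ t in (0:ℝ)..x, h t * f t)) := by
  have hC0 : 0 ≤ C := (norm_nonneg _).trans (hC 0 ⟨le_rfl, hx⟩)
  have key : ∀ n : ℕ, 0 < n →
      ‖rsS g f x n - (g x * f x - g 0 * f 0 - ∫ t in (0:ℝ)..x, h t * f t)‖
        ≤ C * (V x - V 0) * x / n := by
    intro n hn
    have hn' : (0:ℝ) < n := by exact_mod_cast hn
    set u : ℕ → ℝ := fun i => (i:ℝ) * x / n with hu
    have hu0 : u 0 = 0 := by simp [hu]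
    have hun : u n = x := by simp only [hu]; field_simp
    have hstep : ∀ i, u (i+1) - u i = x / n := by
      intro i; simp only [hu]; push_cast; field_simp; ring
    have hmono : ∀ i, u i ≤ u (i+1) := by
      intro i; have := hstep i; have : 0 ≤ x / n := by positivity
      linarith
    have hu_nn : ∀ i, 0 ≤ u i := fun i => by simp only [hu]; positivity
    have hu_le : ∀ i, i ≤ n → u i ≤ x := by
      intro i hi
      have : (i:ℝ) ≤ n := by exact_mod_cast hi
      simp only [hu]; rw [div_le_iff₀ hn']; nlinarith
    have hS : rsS g f x n = ∑ i ∈ Finset.range n, g (u i) * (f (u (i+1)) - f (u i)) := by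
      unfold rsS
      refine Finset.sum_congr rfl fun i _ => ?_
      simp only [hu]; push_cast; simp
    have htel : ∑ i ∈ Finset.range n, (g (u (i+1)) * f (u (i+1)) - g (u i) * f (u i))
        = g x * f x - g 0 * f 0 := by
      rw [Finset.sum_range_sub (fun i => g (u i) * f (u i)), hu0, hun]
    have hsub : ∀ i < n, uIcc (u i) (u (i+1)) ⊆ uIcc 0 x := by
      intro i hi
      rw [uIcc_of_le (hmono i), uIcc_of_le hx]
      exact Icc_subset_Icc (hu_nn i) (hu_le _ hi)
    have hint : ∑ i ∈ Finset.range n, ∫ t in (u i)..(u (i+1)), h t * f t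
        = ∫ t in (0:ℝ)..x, h t * f t := by
      rw [intervalIntegral.sum_integral_adjacent_intervals, hu0, hun]
      intro i hi
      exact hhf.mono_set (hsub i hi)
    rw [hS, ← htel, ← hint, ← Finset.sum_sub_distrib, ← Finset.sum_sub_distrib]
    have hcell : ∀ i ∈ Finset.range n, ‖g (u i) * (f (u (i+1)) - f (u i)) -
        (g (u (i+1)) * f (u (i+1)) - g (u i) * f (u i) - ∫ t in (u i)..(u (i+1)), h t * f t)‖
        ≤ C * (V (u (i+1)) - V (u i)) * (x / n) := by
      intro i hi
      have hi := Finset.mem_range.1 hi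
      have hhi := hh.mono_set (hsub i hi)
      have hgd : g (u (i+1)) - g (u i) = ∫ t in (u i)..(u (i+1)), h t := by
        rw [hg _ ⟨hu_nn _, hu_le _ hi⟩, hg _ ⟨hu_nn _, hu_le _ hi.le⟩, add_sub_add_left_eq_sub]
        apply intervalIntegral.integral_interval_sub_left
        · refine hh.mono_set ?_
          rw [uIcc_of_le (hu_nn _), uIcc_of_le hx]
          exact Icc_subset_Icc le_rfl (hu_le _ hi)
        · refine hh.mono_set ?_
          rw [uIcc_of_le (hu_nn _), uIcc_of_le hx]
          exact Icc_subset_Icc le_rfl (hu_le _ hi.le)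
      have e : g (u i) * (f (u (i+1)) - f (u i)) -
        (g (u (i+1)) * f (u (i+1)) - g (u i) * f (u i) - ∫ t in (u i)..(u (i+1)), h t * f t)
        = ∫ t in (u i)..(u (i+1)), (h t * f t - h t * f (u (i+1))) := by
        rw [intervalIntegral.integral_sub (hhf.mono_set (hsub i hi)) (hhi.mul_const _),
          intervalIntegral.integral_mul_const, ← hgd]
        ring
      rw [e, ← hstep i]
      refine (intervalIntegral.norm_integral_le_of_norm_le_const
        (C := C * (V (u (i+1)) - V (u i))) ?_).trans_eq ?_
      · intro t ht
        rw [uIoc_of_le (hmono i)] at ht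
        rw [← mul_sub, norm_mul, norm_sub_rev]
        have h1 := hV t (u (i+1)) ((hu_nn i).trans ht.1.le) ht.2 (hu_le _ hi)
        have h2 := hV (u i) t (hu_nn i) ht.1.le (ht.2.trans (hu_le _ hi))
        have h3 := norm_nonneg (f t - f (u i))
        exact mul_le_mul (hC t ⟨(hu_nn i).trans ht.1.le, ht.2.trans (hu_le _ hi)⟩)
          (by linarith) (norm_nonneg _) hC0
      · rw [abs_of_nonneg (sub_nonneg.2 (hmono i))]
    refine (norm_sum_le _ _).trans ((Finset.sum_le_sum hcell).trans_eq ?_)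
    rw [← Finset.sum_mul, ← Finset.mul_sum, Finset.sum_range_sub (fun i => V (u i)), hu0, hun]
    ring
  rw [tendsto_iff_norm_sub_tendsto_zero]
  refine squeeze_zero' (Eventually.of_forall fun _ => norm_nonneg _)
    ((eventually_gt_atTop 0).mono key) ?_
  exact tendsto_const_div_atTop_nhds_zero_nat _

lemma rsS_bound (g f V : ℝ → ℝ) (D : ℝ)
    (hV : ∀ s t, 0 ≤ s → s ≤ t → t ≤ 1 → ‖f t - f s‖ ≤ V t - V s)
    (hD : ∀ t ∈ Icc (0:ℝ) 1, |g t| ≤ D) (n : ℕ) : |rsS g f 1 n| ≤ D * (V 1 - V 0) := by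
  have hD0 : 0 ≤ D := (abs_nonneg _).trans (hD 0 ⟨le_rfl, zero_le_one⟩)
  rcases Nat.eq_zero_or_pos n with rfl | hn
  · have := (norm_nonneg _).trans (hV 0 1 le_rfl zero_le_one le_rfl)
    simp [rsS]; positivity
  have hn' : (0:ℝ) < n := by exact_mod_cast hn
  set u : ℕ → ℝ := fun i => (i:ℝ) / n with hu
  have hu0 : u 0 = 0 := by simp [hu]
  have hun : u n = 1 := by simp only [hu]; field_simp
  have hmono : ∀ i, u i ≤ u (i+1) := by
    intro i; simp only [hu]; gcongr; simp
  have hu_nn : ∀ i, 0 ≤ u i := fun i => by simp only [hu]; positivity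
  have hu_le : ∀ i, i ≤ n → u i ≤ 1 := by
    intro i hi
    have : (i:ℝ) ≤ n := by exact_mod_cast hi
    simp only [hu]; rw [div_le_iff₀ hn']; linarith
  have hS : rsS g f 1 n = ∑ i ∈ Finset.range n, g (u i) * (f (u (i+1)) - f (u i)) := by
    unfold rsS
    refine Finset.sum_congr rfl fun i _ => ?_
    simp only [hu]; push_cast; simp
  have : D * (V 1 - V 0) = ∑ i ∈ Finset.range n, D * (V (u (i+1)) - V (u i)) := by
    rw [← Finset.mul_sum, Finset.sum_range_sub (fun i => V (u i)), hu0, hun]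
  rw [hS, this]
  refine (Finset.abs_sum_le_sum_abs _ _).trans (Finset.sum_le_sum fun i hi => ?_)
  have hi := Finset.mem_range.1 hi
  rw [abs_mul]
  exact mul_le_mul (hD _ ⟨hu_nn _, hu_le _ hi.le⟩) (hV _ _ (hu_nn _) (hmono i) (hu_le _ hi))
    (abs_nonneg _) hD0

lemma exists_V (f : ℝ → ℝ) (hf : MemM0 f) : ∃ V : ℝ → ℝ,
    ∀ s t, 0 ≤ s → s ≤ t → t ≤ 1 → ‖f t - f s‖ ≤ V t - V s := by
  have hbv : BoundedVariationOn f (Icc 0 1) := hf.2.2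
  have hl := hbv.locallyBoundedVariationOn
  refine ⟨variationOnFromTo f (Icc 0 1) 0, fun s t hs hst ht => ?_⟩
  have h0 : (0:ℝ) ∈ Icc (0:ℝ) 1 := by simp
  have hs' : s ∈ Icc (0:ℝ) 1 := ⟨hs, hst.trans ht⟩
  have ht' : t ∈ Icc (0:ℝ) 1 := ⟨hs.trans hst, ht⟩
  have := variationOnFromTo.add hl h0 hs' ht'
  have h2 : dist (f t) (f s) ≤ variationOnFromTo f (Icc 0 1) s t := by
    rw [variationOnFromTo.eq_of_le f _ hst, dist_edist]
    refine ENNReal.toReal_mono (hl s t hs' ht') ?_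
    exact eVariationOn.edist_le f ⟨ht', hst, le_rfl⟩ ⟨hs', le_rfl, hst⟩
  rw [← dist_eq_norm]; linarith

lemma intble_of_V (f V : ℝ → ℝ)
    (hV : ∀ s t, 0 ≤ s → s ≤ t → t ≤ 1 → ‖f t - f s‖ ≤ V t - V s) :
    IntervalIntegrable f MeasureTheory.volume 0 1 := by
  have h1 : MonotoneOn V (uIcc 0 1) := by
    rw [uIcc_of_le zero_le_one]
    intro s hs t ht hst
    have := (norm_nonneg _).trans (hV s t hs.1 hst ht.2); linarith
  have h2 : MonotoneOn (fun t => V t - f t) (uIcc 0 1) := by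
    rw [uIcc_of_le zero_le_one]
    intro s hs t ht hst
    have := (le_abs_self _).trans (hV s t hs.1 hst ht.2); simp only; linarith
  have := h1.intervalIntegrable (μ := MeasureTheory.volume) |>.sub
    (h2.intervalIntegrable (μ := MeasureTheory.volume))
  simpa using this

/-- existence of the limit for continuous integrands -/
lemma rsS_exists (g f V : ℝ → ℝ)
    (hV : ∀ s t, 0 ≤ s → s ≤ t → t ≤ 1 → ‖f t - f s‖ ≤ V t - V s) (hg : Continuous g) :
    ∃ l, Tendsto (rsS g f 1) atTop (𝓝 l) := by
  have hV0 := (norm_nonneg _).trans (hV 0 1 le_rfl zero_le_one le_rfl)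
  apply cauchySeq_tendsto_of_complete
  rw [Metric.cauchySeq_iff']
  intro ε hε
  set δ := ε / 4 / (V 1 - V 0 + 1) with hδ
  have hδ0 : 0 < δ := by positivity
  have hδV : δ * (V 1 - V 0) ≤ ε / 4 := by
    rw [hδ, div_mul_eq_mul_div, div_le_iff₀ (by linarith)]; nlinarith
  obtain ⟨P, hP⟩ := exists_polynomial_near_of_continuousOn 0 1 g hg.continuousOn δ hδ0
  have hPd : Continuous fun t => P.derivative.eval t := P.derivative.continuous
  obtain ⟨C, hC⟩ := isCompact_Icc.exists_bound_of_continuousOn (s := Icc (0:ℝ) 1) hPd.continuousOn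
  have hlim := rsS_tendsto (fun t => P.eval t) f (fun t => P.derivative.eval t) V 1 C zero_le_one
    hV (hPd.intervalIntegrable _ _)
    ((intble_of_V f V hV).continuousOn_mul hPd.continuousOn) hC (by
      intro t ht
      rw [intervalIntegral.integral_eq_sub_of_hasDerivAt (fun x _ => P.hasDerivAt x)
        (hPd.intervalIntegrable _ _)]
      ring)
  have hc := hlim.cauchySeq
  rw [Metric.cauchySeq_iff'] at hc
  obtain ⟨N, hN⟩ := hc (ε/4) (by positivity)
  refine ⟨N, fun n hn => ?_⟩
  have hb : ∀ n, |rsS g f 1 n - rsS (fun t => P.eval t) f 1 n| ≤ ε / 4 := by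
    intro n
    have := rsS_bound (fun t => g t - P.eval t) f V δ hV
      (fun t ht => by rw [abs_sub_comm]; exact (hP t ht).le) n
    refine le_trans (le_of_eq ?_) (this.trans hδV)
    unfold rsS
    rw [← Finset.sum_sub_distrib]
    congr 1
    exact Finset.sum_congr rfl fun i _ => by ring
  have h1 := abs_le.1 (hb n)
  have h2 := abs_le.1 (hb N)
  have h3 := hN n hn
  rw [Real.dist_eq, abs_lt] at h3 ⊢
  constructor <;> linarith [h1.1, h1.2, h2.1, h2.2, h3.1, h3.2]
open BoundedContinuousFunction in
lemma exists_clm (f V : ℝ → ℝ)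
    (hV : ∀ s t, 0 ≤ s → s ≤ t → t ≤ 1 → ‖f t - f s‖ ≤ V t - V s) :
    ∃ T : (ℝ →ᵇ ℝ) →L[ℝ] ℝ, ∀ g : ℝ →ᵇ ℝ, T g = RS g f 0 1 := by
  let S : ℕ → (ℝ →ᵇ ℝ) →L[ℝ] ℝ := fun n => ∑ i ∈ Finset.range n,
      (f (0 + ((i : ℝ) + 1) * (1 - 0) / n) - f (0 + (i : ℝ) * (1 - 0) / n)) •
        evalCLM ℝ (0 + (i : ℝ) * (1 - 0) / n)
  have hS : ∀ n (g : ℝ →ᵇ ℝ), S n g = rsS g f 1 n := by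
    intro n g
    simp only [S, rsS, _root_.sum_apply]
    refine Finset.sum_congr rfl fun i _ => ?_
    rw [mul_comm (g _)]; rfl
  have hlim : Tendsto (fun n (g : ℝ →ᵇ ℝ) => S n g) atTop (𝓝 (fun g : ℝ →ᵇ ℝ => RS g f 0 1)) := by
    rw [tendsto_pi_nhds]
    intro g
    obtain ⟨l, hl⟩ := rsS_exists g f V hV g.continuous
    rw [RS_eq_s18 _ _ _ _ hl]
    simpa only [hS] using hl
  exact ⟨continuousLinearMapOfTendsto S hlim, fun g => rfl⟩

lemma integral_indicator_Ioc {F : ℝ → ℝ} {s t : ℝ} (hs : 0 ≤ s) (hst : s ≤ t) (ht : t ≤ 1) :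
    ∫ r in (0:ℝ)..1, (Ioc s t).indicator F r = ∫ r in s..t, F r := by
  rw [intervalIntegral.integral_of_le zero_le_one, intervalIntegral.integral_of_le hst,
    MeasureTheory.setIntegral_indicator measurableSet_Ioc,
    inter_eq_self_of_subset_right (Ioc_subset_Ioc hs ht)]

lemma RS_ind (p V g : ℝ → ℝ)
    (hV : ∀ s t, 0 ≤ s → s ≤ t → t ≤ 1 → ‖p t - p s‖ ≤ V t - V s)
    (hg : ContinuousOn g (Icc 0 1)) {s t : ℝ} (hs : 0 ≤ s) (hst : s ≤ t) (ht : t ≤ 1) :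
    RS (fun r => ∫ u in (0:ℝ)..r, (Ioc s t).indicator g u) p 0 1
      = (∫ u in s..t, g u) * p 1 - ∫ u in s..t, g u * p u := by
  obtain ⟨C, hC⟩ := isCompact_Icc.exists_bound_of_continuousOn hg
  have hC0 : 0 ≤ C := (norm_nonneg _).trans (hC 0 ⟨le_rfl, zero_le_one⟩)
  have hgi : IntervalIntegrable g MeasureTheory.volume 0 1 :=
    ContinuousOn.intervalIntegrable (by rwa [uIcc_of_le zero_le_one])
  have hgp : IntervalIntegrable (fun u => g u * p u) MeasureTheory.volume 0 1 :=
    (intble_of_V p V hV).continuousOn_mul (by rwa [uIcc_of_le zero_le_one])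
  have hind : ∀ F : ℝ → ℝ, IntervalIntegrable F MeasureTheory.volume 0 1 →
      IntervalIntegrable ((Ioc s t).indicator F) MeasureTheory.volume 0 1 := by
    intro F hF
    rw [intervalIntegrable_iff] at hF ⊢
    exact hF.indicator measurableSet_Ioc
  have he : ∀ u, (Ioc s t).indicator g u * p u = (Ioc s t).indicator (fun u => g u * p u) u := by
    intro u; by_cases hu : u ∈ Ioc s t <;> simp [hu]
  have := rsS_tendsto (fun r => ∫ u in (0:ℝ)..r, (Ioc s t).indicator g u) p
    ((Ioc s t).indicator g) V 1 C zero_le_one hV (hind g hgi)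
    (by simp only [he]; exact hind _ hgp)
    (by
      intro u hu
      by_cases h : u ∈ Ioc s t
      · simp only [h, indicator_of_mem]; exact hC u hu
      · simpa [h] using hC0)
    (by intro u hu; simp)
  rw [RS_eq_s18 _ _ _ _ this]
  simp only [he, integral_indicator_Ioc hs hst ht, intervalIntegral.integral_same]
  ring

lemma cont_prim_ind (g : ℝ → ℝ) (hg : ContinuousOn g (Icc 0 1)) {s t : ℝ} (hs : 0 ≤ s)
    (ht : t ≤ 1) :
    Continuous (fun r => ∫ u in (0:ℝ)..r, (Ioc s t).indicator g u) := by
  refine intervalIntegral.continuous_primitive (fun a b => ?_) 0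
  apply MeasureTheory.Integrable.intervalIntegrable
  rw [MeasureTheory.integrable_indicator_iff measurableSet_Ioc]
  exact (hg.integrableOn_Icc).mono_set
    (Ioc_subset_Icc_self.trans (Icc_subset_Icc hs ht))

lemma prim_ind_bound {s t : ℝ} (hst : s ≤ t) (r : ℝ) :
    ‖∫ u in (0:ℝ)..r, (Ioc s t).indicator (fun _ => (1:ℝ)) u‖ ≤ t - s := by
  have hi : MeasureTheory.Integrable ((Ioc s t).indicator (fun _ => (1:ℝ))) := by
    rw [MeasureTheory.integrable_indicator_iff measurableSet_Ioc]
    simp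
  refine intervalIntegral.norm_integral_le_integral_norm_uIoc.trans ?_
  refine (MeasureTheory.setIntegral_le_integral hi.norm
    (Eventually.of_forall fun _ => norm_nonneg _)).trans_eq ?_
  have : (fun a => ‖(Ioc s t).indicator (fun _ => (1:ℝ)) a‖) =
      (Ioc s t).indicator (fun _ => (1:ℝ)) := by
    ext a; by_cases h : a ∈ Ioc s t <;> simp [h]
  rw [this, MeasureTheory.integral_indicator measurableSet_Ioc]
  simp [hst]

open BoundedContinuousFunction in
lemma unif_bound (p : ℕ → ℝ → ℝ) (p0 : ℝ → ℝ) (hpm : ∀ m, MemM0 (p m))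
    (hweak : ∀ g : ℝ → ℝ, Continuous g →
      Tendsto (fun m => RS g (p m) 0 1) atTop (𝓝 (RS g p0 0 1))) :
    ∃ C, ∀ m, ∀ t ∈ Icc (0:ℝ) 1, |p m t| ≤ C := by
  choose V hV using fun m => exists_V (p m) (hpm m)
  choose T hT using fun m => exists_clm (p m) (V m) (hV m)
  obtain ⟨C, hC⟩ := banach_steinhaus (g := T) (by
    intro g
    have := hweak g g.continuous
    obtain ⟨B, hB⟩ := this.norm.bddAbove_range
    refine ⟨B, fun m => ?_⟩
    rw [hT]
    exact hB ⟨m, rfl⟩)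
  have hRS : ∀ m (g : ℝ → ℝ) (D : ℝ), Continuous g → 0 ≤ D → (∀ r, ‖g r‖ ≤ D) →
      |RS g (p m) 0 1| ≤ C * D := by
    intro m g D hg hD hgD
    have h1 := hT m (BoundedContinuousFunction.ofNormedAddCommGroup g hg D hgD)
    have h2 := (T m).le_of_opNorm_le (hC m) (BoundedContinuousFunction.ofNormedAddCommGroup g hg D hgD)
    rw [h1] at h2
    have hC0 : 0 ≤ C := (norm_nonneg _).trans (hC m)
    refine h2.trans (mul_le_mul_of_nonneg_left ?_ hC0)
    exact BoundedContinuousFunction.norm_ofNormedAddCommGroup_le hg hD hgD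
  have hC0 : 0 ≤ C := (norm_nonneg _).trans (hC 0)
  have h1 : ∀ m, |p m 1| ≤ C := by
    intro m
    have h := rsS_tendsto (fun _ => 1) (p m) (fun _ => 0) (V m) 1 0 zero_le_one (hV m)
      (by simp) (by simp) (by simp) (by simp)
    have h2 := hRS m (fun _ => 1) 1 continuous_const zero_le_one (by simp)
    rw [RS_eq_s18 _ _ _ _ h] at h2
    simpa [(hpm m).1] using h2
  refine ⟨2 * C, fun m t ht => ?_⟩
  rcases eq_or_lt_of_le ht.1 with h | h0
  · rw [← h, (hpm m).1]; simpa using hC0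
  rcases eq_or_lt_of_le ht.2 with h | h1'
  · rw [h]; linarith [h1 m]
  have hint := intble_of_V _ _ (hV m)
  have hlip : ∀ r, t < r → r ≤ 1 → |∫ u in t..r, p m u| ≤ 2 * C * (r - t) := by
    intro r hr hr1
    have e := RS_ind (p m) (V m) (fun _ => 1) (hV m) continuousOn_const ht.1 hr.le hr1
    have b := hRS m _ (r - t) (cont_prim_ind (fun _ => 1) continuousOn_const ht.1 hr1)
      (by linarith) (prim_ind_bound hr.le)
    rw [e] at b
    simp only [intervalIntegral.integral_const, smul_eq_mul, mul_one, one_mul] at b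
    have b2 : |(r - t) * p m 1| ≤ (r - t) * C := by
      rw [abs_mul, abs_of_pos (by linarith)]
      exact mul_le_mul_of_nonneg_left (h1 m) (by linarith)
    rw [abs_le] at *
    constructor <;> nlinarith [b.1, b.2, b2.1, b2.2]
  -- derivative of the primitive from the right
  have hint1 : IntervalIntegrable (p m) MeasureTheory.volume t t := by simp
  have hmeas : StronglyMeasurableAtFilter (p m) (𝓝[>] t) MeasureTheory.volume := by
    refine ⟨Ioc t 1, Ioc_mem_nhdsGT h1', ?_⟩
    have : IntervalIntegrable (p m) MeasureTheory.volume t 1 := hint.mono_set (by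
      rw [uIcc_of_le h1'.le, uIcc_of_le zero_le_one]; exact Icc_subset_Icc ht.1 le_rfl)
    exact this.1.aestronglyMeasurable
  have hder := intervalIntegral.integral_hasDerivWithinAt_right (s := Ici t) (t := Ioi t) hint1
    hmeas ((hpm m).2.1 t ⟨h0, h1'⟩)
  have hsl := hder.Ioi_of_Ici
  rw [hasDerivWithinAt_iff_tendsto_slope' (by simp)] at hsl
  refine le_of_tendsto hsl.abs ?_
  filter_upwards [Ioc_mem_nhdsGT h1'] with r hr
  have hrt : 0 < r - t := sub_pos.2 hr.1
  rw [slope_def_field, intervalIntegral.integral_same, sub_zero, abs_div, abs_of_pos hrt,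
    div_le_iff₀ hrt]
  exact hlip r hr.1 hr.2

lemma ptwise (p : ℕ → ℝ → ℝ) (p0 : ℝ → ℝ) (hpm : ∀ m, MemM0 (p m)) (hp0 : MemM0 p0)
    (hweak : ∀ g : ℝ → ℝ, Continuous g →
      Tendsto (fun m => RS g (p m) 0 1) atTop (𝓝 (RS g p0 0 1)))
    (g : ℝ → ℝ) (hg : ContinuousOn g (Icc 0 1)) (x : ℝ) (hx : x ∈ Icc (0:ℝ) 1) :
    Tendsto (fun m => ∫ t in (0:ℝ)..x, g t * (p m t - p0 t)) atTop (𝓝 0) := by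
  choose V hV using fun m => exists_V (p m) (hpm m)
  obtain ⟨V0, hV0⟩ := exists_V p0 hp0
  have h1 : Tendsto (fun m => p m 1) atTop (𝓝 (p0 1)) := by
    have := hweak (fun _ => 1) continuous_const
    have e : ∀ (P V : ℝ → ℝ), MemM0 P →
      (∀ s t, 0 ≤ s → s ≤ t → t ≤ 1 → ‖P t - P s‖ ≤ V t - V s) → RS (fun _ => 1) P 0 1 = P 1 := by
      intro P V hP hV
      have h := rsS_tendsto (fun _ => 1) P (fun _ => 0) V 1 0 zero_le_one hV
        (by simp) (by simp) (by simp) (by simp)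
      rw [RS_eq_s18 _ _ _ _ h]; simp [hP.1]
    rw [e p0 V0 hp0 hV0] at this
    refine this.congr fun m => e _ _ (hpm m) (hV m)
  have h2 := hweak _ (cont_prim_ind g hg le_rfl hx.2)
  rw [RS_ind p0 V0 g hV0 hg le_rfl hx.1 hx.2] at h2
  have h3 := (h1.const_mul (∫ u in (0:ℝ)..x, g u)).sub h2
  have h4 := h3.sub_const (∫ u in (0:ℝ)..x, g u * p0 u)
  have hgp : ∀ P V : ℝ → ℝ, (∀ s t, 0 ≤ s → s ≤ t → t ≤ 1 → ‖P t - P s‖ ≤ V t - V s) →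
      IntervalIntegrable (fun u => g u * P u) MeasureTheory.volume 0 x := by
    intro P V hV
    refine IntervalIntegrable.mono_set ((intble_of_V P V hV).continuousOn_mul
      (by rwa [uIcc_of_le zero_le_one])) ?_
    rw [uIcc_of_le zero_le_one, uIcc_of_le hx.1]; exact Icc_subset_Icc le_rfl hx.2
  refine (h4.congr fun m => ?_).trans_eq (by congr 1; ring)
  rw [RS_ind (p m) (V m) g (hV m) hg le_rfl hx.1 hx.2]
  simp only [mul_sub]
  rw [intervalIntegral.integral_sub (hgp _ _ (hV m)) (hgp _ _ hV0)]
  ring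
lemma unif_of_lip (A : ℕ → ℝ → ℂ) (L : ℝ)
    (hL : ∀ m, ∀ x ∈ Icc (0:ℝ) 1, ∀ y ∈ Icc (0:ℝ) 1, ‖A m x - A m y‖ ≤ L * |x - y|)
    (h : ∀ x ∈ Icc (0:ℝ) 1, Tendsto (fun m => A m x) atTop (𝓝 0)) (ε : ℝ) (hε : 0 < ε) :
    ∀ᶠ m in atTop, ∀ x ∈ Icc (0:ℝ) 1, ‖A m x‖ ≤ ε := by
  have hL0 : 0 ≤ L := by
    have := (norm_nonneg _).trans (hL 0 0 (by simp) 1 (by simp)); simpa using this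
  obtain ⟨N, hN⟩ := exists_nat_gt (2 * L / ε)
  have hN0 : (0:ℝ) < N := lt_of_le_of_lt (by positivity) hN
  have hev : ∀ᶠ m in atTop, ∀ k ∈ Finset.range (N+1), ‖A m ((k:ℝ)/N)‖ < ε / 2 := by
    rw [eventually_all_finset]
    intro k hk
    have hk : (k:ℝ) ≤ N := by exact_mod_cast Nat.lt_succ_iff.1 (Finset.mem_range.1 hk)
    have := (h ((k:ℝ)/N) ⟨by positivity, by rw [div_le_one hN0]; exact hk⟩).norm
    rw [norm_zero] at this
    exact this.eventually_lt_const (by positivity)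
  filter_upwards [hev] with m hm x hx
  set k := ⌊x * N⌋₊ with hk
  have hxN : 0 ≤ x * N := mul_nonneg hx.1 hN0.le
  have hk1 : (k:ℝ) ≤ x * N := Nat.floor_le hxN
  have hk2 : x * N < k + 1 := Nat.lt_floor_add_one _
  have hkN : (k:ℝ) ≤ N := by nlinarith [hx.2]
  have h1 := hm k (by rw [Finset.mem_range]; have : k ≤ N := by exact_mod_cast hkN
                      omega)
  have h2 := hL m x hx ((k:ℝ)/N) ⟨by positivity, by rw [div_le_one hN0]; exact hkN⟩
  have h3 : |x - (k:ℝ)/N| ≤ 1 / N := by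
    have e : x - (k:ℝ)/N = (x * N - k) / N := by field_simp
    rw [e, abs_div, abs_of_pos hN0, abs_of_nonneg (by linarith)]
    gcongr; linarith
  have h4 : L * (1 / N) ≤ ε / 2 := by
    rw [div_lt_iff₀ hε] at hN
    rw [mul_one_div, div_le_iff₀ hN0]; linarith
  have h5 := mul_le_mul_of_nonneg_left h3 hL0
  have h6 : ‖A m x‖ ≤ ‖A m x - A m ((k:ℝ)/N)‖ + ‖A m ((k:ℝ)/N)‖ := by
    simpa using norm_add_le (A m x - A m ((k:ℝ)/N)) (A m ((k:ℝ)/N))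
  linarith

lemma ii_mono {E : Type*} [NormedAddCommGroup E] {F : ℝ → E}
    (h : IntervalIntegrable F MeasureTheory.volume 0 1) {x y : ℝ} (hx : x ∈ Icc (0:ℝ) 1)
    (hy : y ∈ Icc (0:ℝ) 1) :
    IntervalIntegrable F MeasureTheory.volume x y := by
  refine h.mono_set ?_
  rw [uIcc_of_le zero_le_one]
  exact uIcc_subset_Icc hx hy

lemma ii_ofReal {f : ℝ → ℝ} {x y : ℝ} (h : IntervalIntegrable f MeasureTheory.volume x y) :
    IntervalIntegrable (fun t => (f t : ℂ)) MeasureTheory.volume x y :=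
  ⟨h.1.ofReal, h.2.ofReal⟩

lemma ii_cont_mul {g f : ℝ → ℂ} (hg : ContinuousOn g (Icc 0 1))
    (h : IntervalIntegrable f MeasureTheory.volume 0 1) :
    IntervalIntegrable (fun t => g t * f t) MeasureTheory.volume 0 1 :=
  h.continuousOn_mul (by rwa [uIcc_of_le zero_le_one])

lemma cont_prim {F : ℝ → ℂ} (h : IntervalIntegrable F MeasureTheory.volume 0 1) :
    ContinuousOn (fun x => ∫ t in (0:ℝ)..x, F t) (Icc 0 1) := by
  have := intervalIntegral.continuousOn_primitive_interval (a := 0) (b := 1) (f := F)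
    (μ := MeasureTheory.volume) (by
      rw [uIcc_of_le zero_le_one, integrableOn_Icc_iff_integrableOn_Ioc]; exact h.1)
  rwa [uIcc_of_le zero_le_one] at this

lemma unif_conv (p : ℕ → ℝ → ℝ) (p0 : ℝ → ℝ) (hpm : ∀ m, MemM0 (p m)) (hp0 : MemM0 p0)
    (hweak : ∀ g : ℝ → ℝ, Continuous g →
      Tendsto (fun m => RS g (p m) 0 1) atTop (𝓝 (RS g p0 0 1)))
    (C : ℝ) (hC : ∀ m, ∀ t ∈ Icc (0:ℝ) 1, |p m t| ≤ C) (hC0 : ∀ t ∈ Icc (0:ℝ) 1, |p0 t| ≤ C)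
    (g : ℝ → ℂ) (hg : ContinuousOn g (Icc 0 1)) (ε : ℝ) (hε : 0 < ε) :
    ∀ᶠ m in atTop, ∀ x ∈ Icc (0:ℝ) 1,
      ‖∫ t in (0:ℝ)..x, g t * ((p m t - p0 t : ℝ) : ℂ)‖ ≤ ε := by
  have hdi : ∀ m, IntervalIntegrable (fun t => p m t - p0 t) MeasureTheory.volume 0 1 := by
    intro m
    obtain ⟨V, hV⟩ := exists_V _ (hpm m)
    obtain ⟨V0, hV0⟩ := exists_V _ hp0
    exact (intble_of_V _ _ hV).sub (intble_of_V _ _ hV0)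
  obtain ⟨G, hG⟩ := isCompact_Icc.exists_bound_of_continuousOn hg
  have hG0 : 0 ≤ G := (norm_nonneg _).trans (hG 0 ⟨le_rfl, zero_le_one⟩)
  have hF := fun m => ii_cont_mul hg (ii_ofReal (hdi m))
  refine unif_of_lip (fun m x => ∫ t in (0:ℝ)..x, g t * ((p m t - p0 t : ℝ) : ℂ)) (G * (2 * C))
    ?_ ?_ ε hε
  · intro m x hx y hy
    have h0 : (0:ℝ) ∈ Icc (0:ℝ) 1 := by simp
    rw [intervalIntegral.integral_interval_sub_left (ii_mono (hF m) h0 hx)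
      (ii_mono (hF m) h0 hy)]
    refine intervalIntegral.norm_integral_le_of_norm_le_const fun t ht => ?_
    have ht' : t ∈ Icc (0:ℝ) 1 := uIcc_subset_Icc hy hx (uIoc_subset_uIcc ht)
    rw [norm_mul, Complex.norm_real, Real.norm_eq_abs]
    refine mul_le_mul (hG t ht') ?_ (abs_nonneg _) hG0
    have := abs_sub (p m t) (p0 t)
    linarith [hC m t ht', hC0 t ht']
  · intro x hx
    have h0 : (0:ℝ) ∈ Icc (0:ℝ) 1 := by simp
    have hre : ContinuousOn (fun t => (g t).re) (Icc 0 1) :=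
      Complex.continuous_re.comp_continuousOn hg
    have him : ContinuousOn (fun t => (g t).im) (Icc 0 1) :=
      Complex.continuous_im.comp_continuousOn hg
    have h1 := ptwise p p0 hpm hp0 hweak _ hre x hx
    have h2 := ptwise p p0 hpm hp0 hweak _ him x hx
    have h1' := (Complex.continuous_ofReal.tendsto 0).comp h1
    have h2' := (Complex.continuous_ofReal.tendsto 0).comp h2
    have h3 := h1'.add (h2'.const_mul Complex.I)
    simp only [Complex.ofReal_zero, mul_zero, add_zero] at h3
    refine h3.congr fun m => ?_
    have i1 : IntervalIntegrable (fun t => (g t).re * (p m t - p0 t)) MeasureTheory.volume 0 x :=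
      ii_mono ((hdi m).continuousOn_mul (by rwa [uIcc_of_le zero_le_one])) h0 hx
    have i2 : IntervalIntegrable (fun t => (g t).im * (p m t - p0 t)) MeasureTheory.volume 0 x :=
      ii_mono ((hdi m).continuousOn_mul (by rwa [uIcc_of_le zero_le_one])) h0 hx
    simp only [Function.comp]
    rw [← intervalIntegral.integral_ofReal, ← intervalIntegral.integral_ofReal,
      ← intervalIntegral.integral_const_mul, ← intervalIntegral.integral_add (ii_ofReal i1)
        ((ii_ofReal i2).const_mul _)]
    congr 1; ext t
    conv_rhs => rw [← Complex.re_add_im (g t)]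
    push_cast; ring

lemma gron (D : ℝ → ℂ) (hD : ContinuousOn D (Icc 0 1)) (K ε : ℝ) (hK : 0 < K) (hε : 0 ≤ ε)
    (h : ∀ x ∈ Icc (0:ℝ) 1, ‖D x‖ ≤ ε + K * ∫ t in (0:ℝ)..x, ‖D t‖) :
    ∀ x ∈ Icc (0:ℝ) 1, ‖D x‖ ≤ ε * Real.exp K := by
  have hn := hD.norm
  have hi : IntervalIntegrable (fun t => ‖D t‖) MeasureTheory.volume 0 1 :=
    ContinuousOn.intervalIntegrable (by rwa [uIcc_of_le zero_le_one])
  have hU0 : ∀ x ∈ Icc (0:ℝ) 1, 0 ≤ ∫ t in (0:ℝ)..x, ‖D t‖ := fun x hx =>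
    intervalIntegral.integral_nonneg hx.1 fun _ _ => norm_nonneg _
  have hc : ContinuousOn (fun x => ∫ t in (0:ℝ)..x, ‖D t‖) (Icc 0 1) := by
    have := intervalIntegral.continuousOn_primitive_interval (a := 0) (b := 1)
      (f := fun t => ‖D t‖) (μ := MeasureTheory.volume) (by
        rw [uIcc_of_le zero_le_one]; exact hn.integrableOn_Icc)
    rwa [uIcc_of_le zero_le_one] at this
  have key := norm_le_gronwallBound_of_norm_deriv_right_le (f := fun x => ∫ t in (0:ℝ)..x, ‖D t‖)
    (f' := fun x => ‖D x‖) (δ := 0) (K := K) (ε := ε) (a := 0) (b := 1) hc ?_ (by simp) ?_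
  · intro x hx
    have h1 := key x hx
    have h2 := h x hx
    rw [Real.norm_of_nonneg (hU0 x hx), gronwallBound_of_K_ne_0 hK.ne'] at h1
    simp only [sub_zero, zero_mul, zero_add] at h1
    have h3 := mul_le_mul_of_nonneg_left h1 hK.le
    have h4 : K * (ε / K * (Real.exp (K * x) - 1)) = ε * Real.exp (K * x) - ε := by
      field_simp
    have h5 : Real.exp (K * x) ≤ Real.exp K := Real.exp_le_exp.2 (by nlinarith [hx.2])
    have h6 := mul_le_mul_of_nonneg_left h5 hε
    linarith
  · intro x hx
    have hx' : x ∈ Icc (0:ℝ) 1 := ⟨hx.1, hx.2.le⟩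
    apply intervalIntegral.integral_hasDerivWithinAt_right (s := Ici x) (t := Ioi x)
      (ii_mono hi (by simp) hx')
    · refine ⟨Ioc x 1, Ioc_mem_nhdsGT hx.2, ?_⟩
      exact (ii_mono hi hx' (by simp)).1.aestronglyMeasurable
    · refine (hn x hx').mono_of_mem_nhdsWithin ?_
      exact mem_of_superset (Ioc_mem_nhdsGT hx.2) fun t ht => ⟨hx.1.trans ht.1.le, ht.2⟩
  · intro x hx
    have hx' : x ∈ Icc (0:ℝ) 1 := ⟨hx.1, hx.2.le⟩
    rw [norm_norm, Real.norm_of_nonneg (hU0 x hx')]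
    linarith [h x hx']

lemma mu_ii (p q : ℝ → ℝ) (lam : ℂ) (hp : MemM0 p) (hq : MemM0 q) :
    IntervalIntegrable (muCoef p q lam) MeasureTheory.volume 0 1 := by
  obtain ⟨V, hV⟩ := exists_V _ hp
  obtain ⟨W, hW⟩ := exists_V _ hq
  unfold muCoef
  exact ((ii_ofReal (intble_of_V _ _ hW)).sub ((ii_ofReal (intble_of_V _ _ hV)).const_mul _)).add
    ((Complex.continuous_ofReal.intervalIntegrable _ _).const_mul _)

lemma IsSolution.contY {p q : ℝ → ℝ} {lam : ℂ} {y z w : ℝ → ℂ} (h : IsSolution p q lam y z w) :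
    ContinuousOn y (Icc 0 1) := by
  have hz : IntervalIntegrable z MeasureTheory.volume 0 1 :=
    ContinuousOn.intervalIntegrable (by rw [uIcc_of_le zero_le_one]; exact h.1)
  exact (continuousOn_const.add (cont_prim hz)).congr h.2.1

lemma IsSolution.formula {p q : ℝ → ℝ} {lam : ℂ} {y z w : ℝ → ℂ} (h : IsSolution p q lam y z w)
    (hp : MemM0 p) (hq : MemM0 q) :
    ∀ x ∈ Icc (0:ℝ) 1, w x = w 0 - (∫ t in (0:ℝ)..x, 2 * (q t : ℂ) * z t)
      - y x * muCoef p q lam x + ∫ t in (0:ℝ)..x, z t * muCoef p q lam t := by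
  intro x hx
  have hmu0 : muCoef p q lam 0 = 0 := by simp [muCoef, hp.1, hq.1]
  rcases eq_or_lt_of_le hx.1 with hx0 | hx0
  · subst hx0; simp [hmu0]
  have h0 : (0:ℝ) ∈ Icc (0:ℝ) 1 := by simp
  obtain ⟨V, hV⟩ := exists_V _ hp
  obtain ⟨W, hW⟩ := exists_V _ hq
  obtain ⟨C, hC⟩ := isCompact_Icc.exists_bound_of_continuousOn h.1
  have hz : IntervalIntegrable z MeasureTheory.volume 0 1 :=
    ContinuousOn.intervalIntegrable (by rw [uIcc_of_le zero_le_one]; exact h.1)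
  have key := rsS_tendsto y (muCoef p q lam) z (fun t => W t + V t + ‖lam‖ * t) x C hx.1
    (by
      intro s t hs hst ht
      have e : muCoef p q lam t - muCoef p q lam s = ((q t - q s : ℝ) : ℂ)
        - Complex.I * ((p t - p s : ℝ) : ℂ) + lam * Complex.I * ((t - s : ℝ) : ℂ) := by
        simp only [muCoef]; push_cast; ring
      rw [e]
      have n1 := hV s t hs hst (ht.trans hx.2)
      have n2 := hW s t hs hst (ht.trans hx.2)
      refine (norm_add_le _ _).trans ((add_le_add_left (norm_sub_le _ _) _).trans ?_)
      simp only [norm_mul, Complex.norm_I, Complex.norm_real, one_mul, mul_one]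
      rw [Real.norm_of_nonneg (sub_nonneg.2 hst)]
      linarith)
    (ii_mono hz h0 hx) (ii_mono (ii_cont_mul h.1 (mu_ii p q lam hp hq)) h0 hx)
    (fun t ht => hC t ⟨ht.1, ht.2.trans hx.2⟩)
    (fun t ht => h.2.1 t ⟨ht.1, ht.2.trans hx.2⟩)
  rw [h.2.2.2 x ⟨hx0, hx.2⟩, RSC_eq _ _ _ _ key, hmu0]
  ring

lemma IsSolution.intW {p q : ℝ → ℝ} {lam : ℂ} {y z w : ℝ → ℂ} (h : IsSolution p q lam y z w)
    (hp : MemM0 p) (hq : MemM0 q) : IntervalIntegrable w MeasureTheory.volume 0 1 := by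
  have hf := h.formula hp hq
  obtain ⟨W, hW⟩ := exists_V _ hq
  have i1 : IntervalIntegrable (fun t => 2 * (q t : ℂ) * z t) MeasureTheory.volume 0 1 := by
    refine (ii_cont_mul h.1 ((ii_ofReal (intble_of_V _ _ hW)).const_mul 2)).congr ?_
    exact fun t _ => mul_comm _ _
  have i2 := ii_cont_mul h.1 (mu_ii p q lam hp hq)
  have i3 := ii_cont_mul h.contY (mu_ii p q lam hp hq)
  have c1 : IntervalIntegrable (fun x => w 0 - ∫ t in (0:ℝ)..x, 2 * (q t : ℂ) * z t)
      MeasureTheory.volume 0 1 := ContinuousOn.intervalIntegrable (by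
        rw [uIcc_of_le zero_le_one]; exact continuousOn_const.sub (cont_prim i1))
  have c2 : IntervalIntegrable (fun x => ∫ t in (0:ℝ)..x, z t * muCoef p q lam t)
      MeasureTheory.volume 0 1 := ContinuousOn.intervalIntegrable (by
        rw [uIcc_of_le zero_le_one]; exact cont_prim i2)
  refine ((c1.sub i3).add c2).congr fun x hx => ?_
  rw [uIoc_of_le zero_le_one] at hx
  exact (hf x ⟨hx.1.le, hx.2⟩).symm

lemma M0_bound (f : ℝ → ℝ) (hf : MemM0 f) : ∃ C, ∀ t ∈ Icc (0:ℝ) 1, |f t| ≤ C := by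
  obtain ⟨V, hV⟩ := exists_V f hf
  refine ⟨V 1 - V 0, fun t ht => ?_⟩
  have h1 := hV 0 t le_rfl ht.1 ht.2
  have h2 := (norm_nonneg _).trans (hV t 1 ht.1 ht.2 le_rfl)
  rw [hf.1, sub_zero, Real.norm_eq_abs] at h1
  linarith

lemma diff_est {p p0 q : ℝ → ℝ} {lam : ℂ} {y z w y0 z0 w0 : ℝ → ℂ}
    (h : IsSolution p q lam y z w) (h0 : IsSolution p0 q lam y0 z0 w0)
    (hp : MemM0 p) (hp0 : MemM0 p0) (hq : MemM0 q)
    (ey : y 0 = y0 0) (ez : z 0 = z0 0) (ew : w 0 = w0 0) (Q M η : ℝ)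
    (hQ : ∀ t ∈ Icc (0:ℝ) 1, |q t| ≤ Q) (hM : ∀ t ∈ Icc (0:ℝ) 1, ‖muCoef p q lam t‖ ≤ M)
    (h1 : ∀ x ∈ Icc (0:ℝ) 1, ‖∫ t in (0:ℝ)..x, y0 t * ((p t - p0 t : ℝ) : ℂ)‖ ≤ η)
    (h2 : ∀ x ∈ Icc (0:ℝ) 1, ‖∫ t in (0:ℝ)..x, z0 t * ((p t - p0 t : ℝ) : ℂ)‖ ≤ η) :
    ∀ x ∈ Icc (0:ℝ) 1, ‖z x - z0 x‖ ≤ 2 * η + (2 * Q + 2 * M) * ∫ t in (0:ℝ)..x, ‖z t - z0 t‖ := by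
  intro x hx
  have m0 : (0:ℝ) ∈ Icc (0:ℝ) 1 := by simp
  have hQ0 : 0 ≤ Q := (abs_nonneg _).trans (hQ 0 m0)
  have hM0 : 0 ≤ M := (norm_nonneg _).trans (hM 0 m0)
  have hη0 : 0 ≤ η := (norm_nonneg _).trans (h1 0 m0)
  obtain ⟨V, hV⟩ := exists_V _ hp
  obtain ⟨V0, hV0⟩ := exists_V _ hp0
  obtain ⟨W, hW⟩ := exists_V _ hq
  have hd : IntervalIntegrable (fun t => ((p t - p0 t : ℝ) : ℂ)) MeasureTheory.volume 0 1 :=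
    ii_ofReal ((intble_of_V _ _ hV).sub (intble_of_V _ _ hV0))
  have iq : IntervalIntegrable (fun t => 2 * (q t : ℂ)) MeasureTheory.volume 0 1 :=
    (ii_ofReal (intble_of_V _ _ hW)).const_mul 2
  have iz := ii_cont_mul h.1 iq
  have iz0 := ii_cont_mul h0.1 iq
  have imu := mu_ii p q lam hp hq
  have imu0 := mu_ii p0 q lam hp0 hq
  have izm := ii_cont_mul h.1 imu
  have iz0m := ii_cont_mul h0.1 imu0
  have hzc : ContinuousOn (fun t => z t - z0 t) (Icc 0 1) := h.1.sub h0.1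
  have izn : IntervalIntegrable (fun t => ‖z t - z0 t‖) MeasureTheory.volume 0 1 :=
    ContinuousOn.intervalIntegrable (by rw [uIcc_of_le zero_le_one]; exact hzc.norm)
  have izd := ii_cont_mul hzc imu
  have izq := ii_cont_mul hzc iq
  have iyd := ii_cont_mul h0.contY hd
  have izd0 := ii_cont_mul h0.1 hd
  have iB : IntervalIntegrable (fun s => ∫ t in (0:ℝ)..s, z0 t * ((p t - p0 t : ℝ) : ℂ))
      MeasureTheory.volume 0 1 := ContinuousOn.intervalIntegrable (by
        rw [uIcc_of_le zero_le_one]; exact cont_prim izd0)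
  have iw := h.intW hp hq
  have iw0 := h0.intW hp0 hq
  have hzI : IntervalIntegrable z MeasureTheory.volume 0 1 :=
    ContinuousOn.intervalIntegrable (by rw [uIcc_of_le zero_le_one]; exact h.1)
  have hz0I : IntervalIntegrable z0 MeasureTheory.volume 0 1 :=
    ContinuousOn.intervalIntegrable (by rw [uIcc_of_le zero_le_one]; exact h0.1)
  set U := ∫ t in (0:ℝ)..x, ‖z t - z0 t‖ with hU
  have hUs : ∀ s ∈ Icc (0:ℝ) x, ∫ t in (0:ℝ)..s, ‖z t - z0 t‖ ≤ U := by
    intro s hs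
    exact intervalIntegral.integral_mono_interval le_rfl hs.1 hs.2
      (Eventually.of_forall fun _ => norm_nonneg _) (ii_mono izn m0 hx)
  have hU0 : 0 ≤ U := by simpa using hUs 0 ⟨le_rfl, hx.1⟩
  have hprod : ∀ (F : ℝ → ℂ) (B : ℝ), 0 ≤ B → (∀ t ∈ Icc (0:ℝ) 1, ‖F t‖ ≤ B) →
      ∀ s ∈ Icc (0:ℝ) x, ‖∫ t in (0:ℝ)..s, (z t - z0 t) * F t‖ ≤ B * U := by
    intro F B hB hF s hs
    have hs1 : s ∈ Icc (0:ℝ) 1 := ⟨hs.1, hs.2.trans hx.2⟩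
    have := intervalIntegral.norm_integral_le_of_norm_le (μ := MeasureTheory.volume)
      (f := fun t => (z t - z0 t) * F t) (g := fun t => B * ‖z t - z0 t‖) hs.1
      (Eventually.of_forall fun t ht => by
        rw [norm_mul, mul_comm]
        exact mul_le_mul_of_nonneg_right (hF t ⟨ht.1.le, ht.2.trans hs1.2⟩) (norm_nonneg _))
      ((ii_mono izn m0 hs1).const_mul B)
    refine this.trans ?_
    rw [intervalIntegral.integral_const_mul]
    exact mul_le_mul_of_nonneg_left (hUs s hs) hB
  -- the remainder
  set R : ℝ → ℂ := fun s => (w s - w0 s) - Complex.I * (y0 s * ((p s - p0 s : ℝ) : ℂ))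
    + Complex.I * ∫ t in (0:ℝ)..s, z0 t * ((p t - p0 t : ℝ) : ℂ) with hR
  have hReq : ∀ s ∈ Icc (0:ℝ) x, R s = - (∫ t in (0:ℝ)..s, (z t - z0 t) * (2 * (q t : ℂ)))
      - (∫ t in (0:ℝ)..s, (z t - z0 t) * 1) * muCoef p q lam s
      + ∫ t in (0:ℝ)..s, (z t - z0 t) * muCoef p q lam t := by
    intro s hs
    have hs1 : s ∈ Icc (0:ℝ) 1 := ⟨hs.1, hs.2.trans hx.2⟩
    have a1 : ∫ t in (0:ℝ)..s, (z t - z0 t) * (2 * (q t : ℂ)) =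
        (∫ t in (0:ℝ)..s, 2 * (q t : ℂ) * z t) - ∫ t in (0:ℝ)..s, 2 * (q t : ℂ) * z0 t := by
      simp only [mul_comm (2 * (q _ : ℂ)), sub_mul]
      exact intervalIntegral.integral_sub (ii_mono iz m0 hs1) (ii_mono iz0 m0 hs1)
    have a2 : y s - y0 s = ∫ t in (0:ℝ)..s, (z t - z0 t) * 1 := by
      simp only [mul_one]
      rw [intervalIntegral.integral_sub (ii_mono hzI m0 hs1) (ii_mono hz0I m0 hs1),
        h.2.1 s hs1, h0.2.1 s hs1, ey]
      ring
    have a3 : (∫ t in (0:ℝ)..s, z t * muCoef p q lam t)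
        - ∫ t in (0:ℝ)..s, z0 t * muCoef p0 q lam t
        = (∫ t in (0:ℝ)..s, (z t - z0 t) * muCoef p q lam t)
          - Complex.I * ∫ t in (0:ℝ)..s, z0 t * ((p t - p0 t : ℝ) : ℂ) := by
      rw [← intervalIntegral.integral_const_mul,
        ← intervalIntegral.integral_sub (ii_mono izm m0 hs1) (ii_mono iz0m m0 hs1),
        ← intervalIntegral.integral_sub (ii_mono izd m0 hs1)
          ((ii_mono izd0 m0 hs1).const_mul _)]
      congr 1; ext t; simp only [muCoef]; push_cast; ring
    have a4 : muCoef p0 q lam s = muCoef p q lam s + Complex.I * ((p s - p0 s : ℝ) : ℂ) := by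
      simp only [muCoef]; push_cast; ring
    rw [a1, ← a2]
    simp only [hR]
    rw [h.formula hp hq s hs1, h0.formula hp0 hq s hs1, ew]
    linear_combination a3 + y0 s * a4
  have hRb : ∀ s ∈ Icc (0:ℝ) x, ‖R s‖ ≤ (2 * Q + 2 * M) * U := by
    intro s hs
    have hs1 : s ∈ Icc (0:ℝ) 1 := ⟨hs.1, hs.2.trans hx.2⟩
    rw [hReq s hs]
    have b1 := hprod (fun t => 2 * (q t : ℂ)) (2 * Q) (by positivity) (fun t ht => by
      rw [norm_mul, Complex.norm_real, Real.norm_eq_abs]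
      simpa using hQ t ht) s hs
    have b2 := hprod (fun _ => 1) 1 zero_le_one (by simp) s hs
    have b3 := hprod _ M hM0 hM s hs
    have b4 : ‖(∫ t in (0:ℝ)..s, (z t - z0 t) * 1) * muCoef p q lam s‖ ≤ (1 * U) * M := by
      rw [norm_mul]
      exact mul_le_mul b2 (hM s hs1) (norm_nonneg _) (by linarith)
    refine (norm_add_le _ _).trans ((add_le_add_left (norm_sub_le _ _) _).trans ?_)
    rw [norm_neg]
    linarith
  have hRI : IntervalIntegrable R MeasureTheory.volume 0 1 :=
    ((iw.sub iw0).sub (iyd.const_mul _)).add (iB.const_mul _)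
  have hzx : z x - z0 x = (∫ s in (0:ℝ)..x, R s)
      + Complex.I * (∫ s in (0:ℝ)..x, y0 s * ((p s - p0 s : ℝ) : ℂ))
      - Complex.I * ∫ s in (0:ℝ)..x, ∫ t in (0:ℝ)..s, z0 t * ((p t - p0 t : ℝ) : ℂ) := by
    have e1 : z x - z0 x = ∫ s in (0:ℝ)..x, (w s - w0 s) := by
      rw [intervalIntegral.integral_sub (ii_mono iw m0 hx) (ii_mono iw0 m0 hx),
        h.2.2.1 x hx, h0.2.2.1 x hx, ez]
      ring
    rw [e1, ← intervalIntegral.integral_const_mul, ← intervalIntegral.integral_const_mul,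
      ← intervalIntegral.integral_add (ii_mono hRI m0 hx) ((ii_mono iyd m0 hx).const_mul _),
      ← intervalIntegral.integral_sub
        ((ii_mono hRI m0 hx).add ((ii_mono iyd m0 hx).const_mul _))
        ((ii_mono iB m0 hx).const_mul _)]
    congr 1; ext s; simp only [hR]; ring
  have c1 : ‖∫ s in (0:ℝ)..x, R s‖ ≤ (2 * Q + 2 * M) * U := by
    have := intervalIntegral.norm_integral_le_of_norm_le_const (f := R) (a := 0) (b := x)
      (C := (2 * Q + 2 * M) * U) (fun s hs => by
        rw [uIoc_of_le hx.1] at hs; exact hRb s ⟨hs.1.le, hs.2⟩)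
    rw [sub_zero, abs_of_nonneg hx.1] at this
    exact this.trans (mul_le_of_le_one_right (by positivity) hx.2)
  have c2 : ‖∫ s in (0:ℝ)..x, ∫ t in (0:ℝ)..s, z0 t * ((p t - p0 t : ℝ) : ℂ)‖ ≤ η := by
    have := intervalIntegral.norm_integral_le_of_norm_le_const
      (f := fun s => ∫ t in (0:ℝ)..s, z0 t * ((p t - p0 t : ℝ) : ℂ)) (a := 0) (b := x)
      (C := η) (fun s hs => by
        rw [uIoc_of_le hx.1] at hs; exact h2 s ⟨hs.1.le, hs.2.trans hx.2⟩)
    rw [sub_zero, abs_of_nonneg hx.1] at this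
    exact this.trans (mul_le_of_le_one_right hη0 hx.2)
  rw [hzx]
  refine (norm_sub_le _ _).trans ((add_le_add_left (norm_add_le _ _) _).trans ?_)
  rw [norm_mul, norm_mul, Complex.norm_I, one_mul, one_mul]
  linarith [h1 x hx]

/-- If `p_m → p₀` weakly* in `M₀([0,1],𝕂)`, then the solutions converge in `C¹([0,1],ℂ)`:
`y(·,λ,p_m,q) → y(·,λ,p₀,q)` and `y'(·,λ,p_m,q) → y'(·,λ,p₀,q)` uniformly on `[0,1]`. -/
theorem solutions_continuous_in_p_weakstar
    (q : ℝ → ℝ) (hq : MemM0 q) (lam : ℂ)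
    (p : ℕ → ℝ → ℝ) (p0 : ℝ → ℝ) (hpm : ∀ m, MemM0 (p m)) (hp0 : MemM0 p0)
    (hweak : ∀ g : ℝ → ℝ, Continuous g →
      Tendsto (fun m => RS g (p m) 0 1) atTop (𝓝 (RS g p0 0 1)))
    (y z w : ℕ → ℝ → ℂ) (y0 z0 w0 : ℝ → ℂ) (a b c : ℂ)
    (hsol : ∀ m, IsSolution (p m) q lam (y m) (z m) (w m))
    (hsol0 : IsSolution p0 q lam y0 z0 w0)
    (hinit : ∀ m, y m 0 = a ∧ z m 0 = b ∧ w m 0 = c)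
    (hinit0 : y0 0 = a ∧ z0 0 = b ∧ w0 0 = c) :
    TendstoUniformlyOn (fun m x => y m x) y0 atTop (Icc 0 1) ∧
    TendstoUniformlyOn (fun m x => z m x) z0 atTop (Icc 0 1) := by
  obtain ⟨C1, hC1⟩ := unif_bound p p0 hpm hweak
  obtain ⟨C2, hC2⟩ := M0_bound p0 hp0
  obtain ⟨Q, hQ⟩ := M0_bound q hq
  have m0 : (0:ℝ) ∈ Icc (0:ℝ) 1 := by simp
  have hQ0 : 0 ≤ Q := (abs_nonneg _).trans (hQ 0 m0)
  have hC10 : 0 ≤ C1 := (abs_nonneg _).trans (hC1 0 0 m0)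
  set M := Q + C1 + ‖lam‖ with hMdef
  have hM0 : 0 ≤ M := by positivity
  have hM : ∀ m, ∀ t ∈ Icc (0:ℝ) 1, ‖muCoef (p m) q lam t‖ ≤ M := by
    intro m t ht
    unfold muCoef
    refine (norm_add_le _ _).trans ((add_le_add_left (norm_sub_le _ _) _).trans ?_)
    simp only [norm_mul, Complex.norm_I, Complex.norm_real, one_mul, mul_one, Real.norm_eq_abs]
    rw [abs_of_nonneg ht.1]
    have := mul_le_of_le_one_right (norm_nonneg lam) ht.2
    linarith [hQ t ht, hC1 m t ht]
  set K := 2 * Q + 2 * M + 1 with hK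
  have hK0 : 0 < K := by positivity
  have conv : ∀ ε > 0, ∀ᶠ m in atTop, ∀ x ∈ Icc (0:ℝ) 1, ‖z m x - z0 x‖ ≤ ε := by
    intro ε hε
    set η := ε / (2 * Real.exp K) with hη
    have hη0 : 0 < η := by positivity
    have u1 := unif_conv p p0 hpm hp0 hweak (max C1 C2)
      (fun m t ht => (hC1 m t ht).trans (le_max_left _ _))
      (fun t ht => (hC2 t ht).trans (le_max_right _ _)) y0 hsol0.contY η hη0
    have u2 := unif_conv p p0 hpm hp0 hweak (max C1 C2)
      (fun m t ht => (hC1 m t ht).trans (le_max_left _ _))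
      (fun t ht => (hC2 t ht).trans (le_max_right _ _)) z0 hsol0.1 η hη0
    filter_upwards [u1, u2] with m hm1 hm2 x hx
    have d := diff_est (hsol m) hsol0 (hpm m) hp0 hq
      ((hinit m).1.trans hinit0.1.symm) ((hinit m).2.1.trans hinit0.2.1.symm)
      ((hinit m).2.2.trans hinit0.2.2.symm) Q M η hQ (hM m) hm1 hm2
    have g := gron (fun t => z m t - z0 t) ((hsol m).1.sub hsol0.1) K (2 * η) hK0
      (by positivity) (fun x hx => by
        have h1 := d x hx
        have h2 : 0 ≤ ∫ t in (0:ℝ)..x, ‖z m t - z0 t‖ :=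
          intervalIntegral.integral_nonneg hx.1 fun _ _ => norm_nonneg _
        simp only [hK]
        linarith) x hx
    refine g.trans_eq ?_
    rw [hη]; field_simp
  have zI : ∀ {P : ℝ → ℝ} {Y Z W : ℝ → ℂ}, IsSolution P q lam Y Z W →
      IntervalIntegrable Z MeasureTheory.volume 0 1 := fun h =>
    ContinuousOn.intervalIntegrable (by rw [uIcc_of_le zero_le_one]; exact h.1)
  constructor
  · rw [Metric.tendstoUniformlyOn_iff]
    intro ε hε
    filter_upwards [conv (ε/2) (by positivity)] with m hm x hx
    rw [dist_comm, dist_eq_norm]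
    have e : y m x - y0 x = ∫ t in (0:ℝ)..x, (z m t - z0 t) := by
      rw [intervalIntegral.integral_sub (ii_mono (zI (hsol m)) m0 hx)
        (ii_mono (zI hsol0) m0 hx), (hsol m).2.1 x hx, hsol0.2.1 x hx, (hinit m).1, hinit0.1]
      ring
    rw [e]
    have := intervalIntegral.norm_integral_le_of_norm_le_const
      (f := fun t => z m t - z0 t) (a := 0) (b := x)
      (C := ε / 2) (fun s hs => by
        rw [uIoc_of_le hx.1] at hs; exact hm s ⟨hs.1.le, hs.2.trans hx.2⟩)
    rw [sub_zero, abs_of_nonneg hx.1] at this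
    have h2 := mul_le_of_le_one_right (a := ε / 2) (by positivity) hx.2
    linarith
  · rw [Metric.tendstoUniformlyOn_iff]
    intro ε hε
    filter_upwards [conv (ε/2) (by positivity)] with m hm x hx
    rw [dist_comm, dist_eq_norm]
    linarith [hm x hx]
end
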